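/- arXiv:1411.3659 — 2 statements merged into one kernel-verified Lean document; each statement's English description precedes it below -/
import Mathlib

section
/- (Dual weighted L⁴ Strichartz estimate, Proposition 4.2, second estimate.) For every bounded interval I ⊂ ℝ and every ε > 0 there exists a constant C(I, ε) > 0 such that the following holds for every N ≥ 1. Let c : S_N × ℝ → ℂ be measurable with ∑_{n ∈ S_N} ∫_ℝ |c(n, τ)|² dτ < ∞. Then the function g(t, x) = ∑_{n ∈ S_N} ∫_ℝ c(n, τ) ⟨|τ| − ⟨n⟩⟩^{−(1/2+ε)} exp(i(n·x + tτ)) dτ (whose τ-integrals converge absolutely by the Cauchy–Schwarz inequality) satisfies ‖g‖_{L⁴(I × T³)} ≤ C(I, ε) N^{1/2} (∑_{n ∈ S_N} ∫_ℝ |c(n, τ)|² dτ)^{1/2}. -/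
open MeasureTheory

/-- The torus `T³`, realized as the cube `[0, 2π)³` in `ℝ³` (with Lebesgue measure). -/
noncomputable def cube : Set (Fin 3 → ℝ) := Set.univ.pi fun _ => Set.Ico (0:ℝ) (2 * Real.pi)

/-- The Euclidean norm `|n|` of a lattice point `n ∈ ℤ³`. -/
noncomputable def normZ (n : Fin 3 → ℤ) : ℝ := Real.sqrt (∑ i, ((n i : ℝ)) ^ 2)

/-- The Japanese bracket `⟨n⟩ = (1 + |n|²)^{1/2}` of a lattice point `n ∈ ℤ³`. -/
noncomputable def jbZ (n : Fin 3 → ℤ) : ℝ := Real.sqrt (1 + ∑ i, ((n i : ℝ)) ^ 2)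

/-- The Japanese bracket `⟨s⟩ = (1 + s²)^{1/2}` of a real number `s`. -/
noncomputable def jbR (s : ℝ) : ℝ := Real.sqrt (1 + s ^ 2)

/-- The Euclidean inner product `n·x` for `n ∈ ℤ³`, `x ∈ ℝ³`. -/
noncomputable def dotZ (n : Fin 3 → ℤ) (x : Fin 3 → ℝ) : ℝ := ∑ i, (n i : ℝ) * x i

open scoped Classical in
/-- The dyadic annulus `S_N = {n ∈ ℤ³ : N ≤ |n| < 2N}`, as a finite set of lattice points. -/
noncomputable def annulus (N : ℝ) : Finset (Fin 3 → ℤ) :=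
  (Finset.Icc (fun _ => -⌈2 * N⌉) fun _ => ⌈2 * N⌉).filter fun n =>
    N ≤ normZ n ∧ normZ n < 2 * N

/-- The Euclidean norm on `Fin 3 → ℝ`. -/
noncomputable def euclNorm (x : Fin 3 → ℝ) : ℝ := Real.sqrt (∑ i, x i ^ 2)

lemma euclNorm_eq_norm (x : Fin 3 → ℝ) :
    euclNorm x = ‖(WithLp.toLp 2 x : EuclideanSpace ℝ (Fin 3))‖ := by
  simp [euclNorm, EuclideanSpace.norm_eq]

lemma euclNorm_nonneg (x : Fin 3 → ℝ) : 0 ≤ euclNorm x := Real.sqrt_nonneg _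

lemma euclNorm_sq (x : Fin 3 → ℝ) : euclNorm x ^ 2 = ∑ i, x i ^ 2 :=
  Real.sq_sqrt (Finset.sum_nonneg fun _ _ => sq_nonneg _)

lemma euclNorm_add_le (x y : Fin 3 → ℝ) : euclNorm (x + y) ≤ euclNorm x + euclNorm y := by
  simp only [euclNorm_eq_norm, WithLp.toLp_add]
  exact norm_add_le _ _

lemma euclNorm_neg (x : Fin 3 → ℝ) : euclNorm (-x) = euclNorm x := by
  simp [euclNorm]

lemma euclNorm_sub_comm (x y : Fin 3 → ℝ) : euclNorm (x - y) = euclNorm (y - x) := by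
  rw [← euclNorm_neg, neg_sub]

lemma continuous_euclNorm : Continuous euclNorm := by
  unfold euclNorm
  fun_prop

/-- The matrix mapping the solid ellipsoid `|x| + |k - x| ≤ τ`, recentred at the origin, onto the
Euclidean unit ball; here `s = (τ² - |k|²)^{1/2}`. -/
noncomputable def ellipsoidMatrix (k : Fin 3 → ℝ) (τ s : ℝ) : Matrix (Fin 3) (Fin 3) ℝ :=
  Matrix.of fun i j => 2 / s * ((if i = j then 1 else 0) - k i * k j / (τ * (τ + s)))

lemma det_ellipsoidMatrix {k : Fin 3 → ℝ} {τ s : ℝ} (hτ : 0 < τ) (hs : 0 < s)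
    (h : s ^ 2 = τ ^ 2 - euclNorm k ^ 2) :
    (ellipsoidMatrix k τ s).det = 8 / (s ^ 2 * τ) := by
  rw [euclNorm_sq, Fin.sum_univ_three] at h
  have hts : 0 < τ + s := by positivity
  have e : (ellipsoidMatrix k τ s).det
      = 8 / s ^ 3 * (1 - (k 0 ^ 2 + k 1 ^ 2 + k 2 ^ 2) / (τ * (τ + s))) := by
    rw [Matrix.det_fin_three]
    simp [ellipsoidMatrix]
    field_simp
    ring
  have h' : k 0 ^ 2 + k 1 ^ 2 + k 2 ^ 2 = (τ - s) * (τ + s) := by linarith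
  rw [e, h']
  field_simp
  ring

lemma euclNorm_ellipsoidMatrix_sq {k : Fin 3 → ℝ} {τ s : ℝ} (hτ : 0 < τ) (hs : 0 < s)
    (h : s ^ 2 = τ ^ 2 - euclNorm k ^ 2) (y : Fin 3 → ℝ) :
    euclNorm (Matrix.toLin' (ellipsoidMatrix k τ s) y) ^ 2
      = 4 / (s ^ 2 * τ ^ 2) * (τ ^ 2 * euclNorm y ^ 2 - (∑ i, k i * y i) ^ 2) := by
  rw [euclNorm_sq, Fin.sum_univ_three] at h
  have hts : 0 < τ + s := by positivity
  have h' : k 0 ^ 2 + k 1 ^ 2 + k 2 ^ 2 = (τ - s) * (τ + s) := by linarith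
  have e : euclNorm (Matrix.toLin' (ellipsoidMatrix k τ s) y) ^ 2
      = 4 / s ^ 2 * (euclNorm y ^ 2 - 2 * (∑ i, k i * y i) ^ 2 / (τ * (τ + s))
        + (∑ i, k i * y i) ^ 2 * (k 0 ^ 2 + k 1 ^ 2 + k 2 ^ 2) / (τ * (τ + s)) ^ 2) := by
    rw [euclNorm_sq, euclNorm_sq, Fin.sum_univ_three, Fin.sum_univ_three, Fin.sum_univ_three]
    simp [ellipsoidMatrix, Matrix.toLin'_apply, Matrix.mulVec, dotProduct, Fin.sum_univ_three]
    field_simp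
    ring
  rw [e, h']
  field_simp
  ring

/-- The solid ellipsoid with foci `0` and `k`. -/
def ellipsoid (k : Fin 3 → ℝ) (τ : ℝ) : Set (Fin 3 → ℝ) :=
  {x | euclNorm x + euclNorm (k - x) ≤ τ}

lemma measurableSet_ellipsoid (k : Fin 3 → ℝ) (τ : ℝ) : MeasurableSet (ellipsoid k τ) :=
  (isClosed_le (continuous_euclNorm.add (continuous_euclNorm.comp (continuous_const.sub
    continuous_id))) continuous_const).measurableSet

lemma ellipsoid_eq_preimage {k : Fin 3 → ℝ} {τ s : ℝ} (hτ : euclNorm k < τ) (hs : 0 < s)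
    (h : s ^ 2 = τ ^ 2 - euclNorm k ^ 2) :
    ellipsoid k τ = (fun x => x - (2⁻¹ : ℝ) • k) ⁻¹'
      (Matrix.toLin' (ellipsoidMatrix k τ s) ⁻¹' {y | euclNorm y ≤ 1}) := by
  have hτ0 : 0 < τ := (euclNorm_nonneg k).trans_lt hτ
  ext x
  have hy : ∀ y, euclNorm y ≤ 1 ↔ euclNorm y ^ 2 ≤ 1 := fun y => by
    rw [sq_le_one_iff₀ (euclNorm_nonneg y)]
  simp only [ellipsoid, Set.mem_ofPred_eq, Set.mem_preimage, hy,
    euclNorm_ellipsoidMatrix_sq hτ0 hs h]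
  have h1 : euclNorm x ^ 2 + euclNorm (k - x) ^ 2
      = 2 * euclNorm (x - (2⁻¹ : ℝ) • k) ^ 2 + euclNorm k ^ 2 / 2 := by
    simp only [euclNorm_sq, Fin.sum_univ_three, Pi.sub_apply, Pi.smul_apply, smul_eq_mul]
    ring
  have h2 : euclNorm x ^ 2 - euclNorm (k - x) ^ 2
      = 2 * ∑ i, k i * (x - (2⁻¹ : ℝ) • k) i := by
    simp only [euclNorm_sq, Fin.sum_univ_three, Pi.sub_apply, Pi.smul_apply, smul_eq_mul]
    ring
  have h3 : euclNorm x ≤ euclNorm k + euclNorm (k - x) := by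
    have := euclNorm_add_le k (x - k)
    rwa [add_sub_cancel, euclNorm_sub_comm x k] at this
  have h4 : euclNorm (k - x) ≤ euclNorm k + euclNorm x := by
    have := euclNorm_add_le k (-x)
    rwa [← sub_eq_add_neg, euclNorm_neg] at this
  have p0 := euclNorm_nonneg x
  have q0 := euclNorm_nonneg (k - x)
  have k0 := euclNorm_nonneg k
  set p := euclNorm x
  set q := euclNorm (k - x)
  set Y := euclNorm (x - (2⁻¹ : ℝ) • k)
  set D := ∑ i, k i * (x - (2⁻¹ : ℝ) • k) i
  have key : 4 / (s ^ 2 * τ ^ 2) * (τ ^ 2 * Y ^ 2 - D ^ 2) ≤ 1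
      ↔ 0 ≤ (τ - (p + q)) * ((τ + (p + q)) * (τ - (p - q)) * (τ + (p - q))) := by
    rw [div_mul_eq_mul_div, div_le_one (by positivity), ← sub_nonneg]
    have hY : Y ^ 2 = (p ^ 2 + q ^ 2 - euclNorm k ^ 2 / 2) / 2 := by linarith
    have hD : D = (p ^ 2 - q ^ 2) / 2 := by linarith
    have : s ^ 2 * τ ^ 2 - 4 * (τ ^ 2 * Y ^ 2 - D ^ 2)
        = (τ - (p + q)) * ((τ + (p + q)) * (τ - (p - q)) * (τ + (p - q))) := by
      rw [hY, hD, h]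
      ring
    rw [this]
  rw [key]
  have pos : 0 < (τ + (p + q)) * (τ - (p - q)) * (τ + (p - q)) :=
    mul_pos (mul_pos (by linarith) (by linarith)) (by linarith)
  rw [mul_nonneg_iff_of_pos_right pos, sub_nonneg]

/-- The volume of the Euclidean unit ball. -/
noncomputable def ballVolume : ℝ := volume.real {y : Fin 3 → ℝ | euclNorm y ≤ 1}

lemma ballVolume_nonneg : 0 ≤ ballVolume := measureReal_nonneg

lemma volume_ball_ne_top : volume {y : Fin 3 → ℝ | euclNorm y ≤ 1} ≠ ⊤ := by
  refine ne_top_of_le_ne_top ?_ (measure_mono (t := Set.Icc (fun _ => (-1 : ℝ)) fun _ => 1) ?_)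
  · exact (isCompact_Icc.measure_lt_top).ne
  · intro y hy
    have h : ∀ i, |y i| ≤ 1 := fun i => by
      refine le_trans ?_ hy
      refine Real.le_sqrt_of_sq_le ?_
      rw [sq_abs]
      exact Finset.single_le_sum (f := fun i => y i ^ 2) (fun _ _ => sq_nonneg _)
        (Finset.mem_univ i)
    exact ⟨fun i => (abs_le.1 (h i)).1, fun i => (abs_le.1 (h i)).2⟩

lemma volume_ellipsoid {k : Fin 3 → ℝ} {τ : ℝ} (hτ : euclNorm k < τ) :
    volume (ellipsoid k τ)
      = ENNReal.ofReal (ballVolume / 8 * (τ * (τ ^ 2 - euclNorm k ^ 2))) := by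
  have hτ0 : 0 < τ := (euclNorm_nonneg k).trans_lt hτ
  have hpos : 0 < τ ^ 2 - euclNorm k ^ 2 := by
    have := euclNorm_nonneg k
    nlinarith
  set s := Real.sqrt (τ ^ 2 - euclNorm k ^ 2) with hs
  have hs0 : 0 < s := Real.sqrt_pos.2 hpos
  have hs2 : s ^ 2 = τ ^ 2 - euclNorm k ^ 2 := Real.sq_sqrt hpos.le
  have hdet : LinearMap.det (Matrix.toLin' (ellipsoidMatrix k τ s)) = 8 / (s ^ 2 * τ) := by
    rw [LinearMap.det_toLin', det_ellipsoidMatrix hτ0 hs0 hs2]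
  have hdet0 : 0 < 8 / (s ^ 2 * τ) := by positivity
  rw [ellipsoid_eq_preimage hτ hs0 hs2,
    show (fun x : Fin 3 → ℝ => x - (2⁻¹ : ℝ) • k) = fun x => x + -((2⁻¹ : ℝ) • k) from
      funext fun _ => sub_eq_add_neg _ _, measure_preimage_add_right,
    Measure.addHaar_preimage_linearMap _ (by rw [hdet]; exact hdet0.ne'), hdet,
    abs_of_pos (inv_pos.2 hdet0), ← ofReal_measureReal volume_ball_ne_top,
    ← ENNReal.ofReal_mul (by positivity), ← hs2]
  congr 1
  simp only [ballVolume]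
  field_simp

lemma volume_ellipsoid_shell_le {k : Fin 3 → ℝ} {σ r M : ℝ} (hr : 0 < r)
    (hk : euclNorm k < σ + r) (hM : σ + r ≤ M) :
    volume (ellipsoid k (σ + r) \ ellipsoid k (σ - r))
      ≤ ENNReal.ofReal (ballVolume / 8 * (6 * r * M ^ 2)) := by
  have k0 := euclNorm_nonneg k
  by_cases h : euclNorm k < σ - r
  · have hsub : ellipsoid k (σ - r) ⊆ ellipsoid k (σ + r) := fun x hx =>
      le_trans (b := σ - r) hx (by linarith)
    rw [measure_sdiff hsub (measurableSet_ellipsoid _ _).nullMeasurableSet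
      (by rw [volume_ellipsoid h]; exact ENNReal.ofReal_ne_top),
      volume_ellipsoid h, volume_ellipsoid hk, ← ENNReal.ofReal_sub]
    · refine ENNReal.ofReal_le_ofReal ?_
      rw [← mul_sub]
      refine mul_le_mul_of_nonneg_left ?_ (div_nonneg ballVolume_nonneg (by norm_num))
      have h1 : (σ + r) ^ 2 ≤ M ^ 2 := pow_le_pow_left₀ (by linarith) hM 2
      have h2 : 0 ≤ euclNorm k ^ 2 := sq_nonneg _
      have h3 : 0 ≤ σ * r := mul_nonneg (by linarith) hr.le
      nlinarith [mul_le_mul_of_nonneg_left h1 hr.le, mul_nonneg hr.le h2, mul_nonneg hr.le h3,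
        pow_pos hr 3]
    · have : 0 ≤ (σ - r) ^ 2 - euclNorm k ^ 2 := by nlinarith
      exact mul_nonneg (div_nonneg ballVolume_nonneg (by norm_num))
        (mul_nonneg (by linarith) this)
  · push Not at h
    refine (measure_mono Set.sdiff_subset).trans ?_
    rw [volume_ellipsoid hk]
    refine ENNReal.ofReal_le_ofReal ?_
    refine mul_le_mul_of_nonneg_left ?_ (div_nonneg ballVolume_nonneg (by norm_num))
    have h1 : (σ + r) ^ 2 - euclNorm k ^ 2 ≤ 2 * r * (2 * M) := by
      have : (σ + r) ^ 2 - euclNorm k ^ 2 = (σ + r - euclNorm k) * (σ + r + euclNorm k) := by ring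
      rw [this]
      exact mul_le_mul (by linarith) (by linarith) (by linarith) (by linarith)
    calc (σ + r) * ((σ + r) ^ 2 - euclNorm k ^ 2) ≤ M * (2 * r * (2 * M)) :=
          mul_le_mul hM h1 (by nlinarith) (by linarith)
      _ ≤ 6 * r * M ^ 2 := by nlinarith [sq_nonneg M, mul_nonneg hr.le (sq_nonneg M)]

/-- The inclusion of the lattice `ℤ³` into `ℝ³`. -/
def latticeCast (n : Fin 3 → ℤ) : Fin 3 → ℝ := fun i => (n i : ℝ)

lemma normZ_eq_euclNorm (n : Fin 3 → ℤ) : normZ n = euclNorm (latticeCast n) := rfl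

lemma normZ_nonneg (n : Fin 3 → ℤ) : 0 ≤ normZ n := Real.sqrt_nonneg _

lemma normZ_le_jbZ (n : Fin 3 → ℤ) : normZ n ≤ jbZ n := Real.sqrt_le_sqrt (by linarith)

lemma jbZ_le_normZ_add_one (n : Fin 3 → ℤ) : jbZ n ≤ normZ n + 1 := by
  have h0 : 0 ≤ ∑ i, (n i : ℝ) ^ 2 := Finset.sum_nonneg fun _ _ => sq_nonneg _
  refine Real.sqrt_le_iff.2 ⟨by linarith [normZ_nonneg n], ?_⟩
  have : normZ n ^ 2 = ∑ i, (n i : ℝ) ^ 2 := Real.sq_sqrt h0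
  nlinarith [normZ_nonneg n]

/-- The half-open unit cube with lowest corner `n`. -/
def unitCube (n : Fin 3 → ℤ) : Set (Fin 3 → ℝ) :=
  Set.univ.pi fun i => Set.Ico (n i : ℝ) (n i + 1)

lemma measurableSet_unitCube (n : Fin 3 → ℤ) : MeasurableSet (unitCube n) :=
  MeasurableSet.univ_pi fun _ => measurableSet_Ico

lemma volume_unitCube (n : Fin 3 → ℤ) : volume (unitCube n) = 1 := by
  simp [unitCube, Real.volume_pi_Ico]

lemma disjoint_unitCube {m n : Fin 3 → ℤ} (h : m ≠ n) :
    Disjoint (unitCube m) (unitCube n) := by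
  refine Set.disjoint_left.2 fun x hm hn => h (funext fun i => ?_)
  have h1 := hm i (Set.mem_univ i)
  have h2 := hn i (Set.mem_univ i)
  rw [← Int.floor_eq_iff.2 h1, ← Int.floor_eq_iff.2 h2]

lemma euclNorm_sub_le_of_mem_unitCube {n : Fin 3 → ℤ} {x : Fin 3 → ℝ} (hx : x ∈ unitCube n) :
    euclNorm (x - latticeCast n) ≤ 2 := by
  refine Real.sqrt_le_iff.2 ⟨by norm_num, ?_⟩
  have h : ∀ i, (x - latticeCast n) i ^ 2 ≤ 1 := fun i => by
    have h1 := hx i (Set.mem_univ i)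
    have h2 : 0 ≤ (x - latticeCast n) i := sub_nonneg.2 h1.1
    have h3 : (x - latticeCast n) i ≤ 1 := by
      have := h1.2
      simp only [latticeCast, Pi.sub_apply]
      linarith
    exact pow_le_one₀ h2 h3
  rw [Fin.sum_univ_three]
  linarith [h 0, h 1, h 2]

open scoped Classical in
lemma card_shell_le :
    ∃ C > (0 : ℝ), ∀ N : ℝ, 1 ≤ N → ∀ (k : Fin 3 → ℤ) (σ : ℝ),
      (((annulus N).filter fun n =>
        k - n ∈ annulus N ∧ |jbZ n + jbZ (k - n) - σ| ≤ 1).card : ℝ) ≤ C * N ^ 2 := by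
  refine ⟨ballVolume / 8 * (6 * 8 * 15 ^ 2) + 1,
    by linarith [ballVolume_nonneg], fun N hN k σ => ?_⟩
  set F := (annulus N).filter fun n =>
    k - n ∈ annulus N ∧ |jbZ n + jbZ (k - n) - σ| ≤ 1 with hF
  have hB := ballVolume_nonneg
  rcases F.eq_empty_or_nonempty with h | ⟨n₀, hn₀⟩
  · rw [h]
    simp only [Finset.card_empty, Nat.cast_zero]
    positivity
  have hcast : ∀ n : Fin 3 → ℤ, latticeCast (k - n) = latticeCast k - latticeCast n := fun n => by
    ext i
    simp [latticeCast]
  have hmem : ∀ n ∈ F, normZ n < 2 * N ∧ normZ (k - n) < 2 * N ∧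
      |jbZ n + jbZ (k - n) - σ| ≤ 1 := fun n hn => by
    simp only [hF, annulus, Finset.mem_filter] at hn
    exact ⟨hn.1.2.2, hn.2.1.2.2, hn.2.2⟩
  have hσ : σ + 8 ≤ 15 * N ∧ euclNorm (latticeCast k) < σ + 8 := by
    obtain ⟨h1, h2, h3⟩ := hmem n₀ hn₀
    have h4 := abs_le.1 h3
    have h5 := jbZ_le_normZ_add_one n₀
    have h6 := jbZ_le_normZ_add_one (k - n₀)
    have h7 := normZ_le_jbZ n₀
    have h8 := normZ_le_jbZ (k - n₀)
    have h9 := euclNorm_add_le (latticeCast n₀) (latticeCast k - latticeCast n₀)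
    rw [add_sub_cancel, ← hcast, ← normZ_eq_euclNorm n₀, ← normZ_eq_euclNorm (k - n₀)] at h9
    constructor <;> linarith
  have hsub : (⋃ n ∈ F, unitCube n) ⊆
      ellipsoid (latticeCast k) (σ + 8) \ ellipsoid (latticeCast k) (σ - 8) := by
    refine Set.iUnion₂_subset fun n hn x hx => ?_
    obtain ⟨-, -, h3⟩ := hmem n hn
    have h4 := abs_le.1 h3
    have h5 := jbZ_le_normZ_add_one n
    have h6 := jbZ_le_normZ_add_one (k - n)
    have h7 := normZ_le_jbZ n
    have h8 := normZ_le_jbZ (k - n)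
    rw [normZ_eq_euclNorm] at h5 h6 h7 h8
    have hd := euclNorm_sub_le_of_mem_unitCube hx
    have a1 := euclNorm_add_le (latticeCast n) (x - latticeCast n)
    have a2 := euclNorm_add_le x (latticeCast n - x)
    have a3 := euclNorm_add_le (latticeCast (k - n)) (latticeCast n - x)
    have a4 := euclNorm_add_le (latticeCast k - x) (x - latticeCast n)
    rw [euclNorm_sub_comm] at hd
    rw [euclNorm_sub_comm x] at a1 a4
    rw [add_sub_cancel] at a1 a2
    rw [hcast, sub_add_sub_cancel, ← hcast] at a3
    rw [sub_add_sub_cancel, ← hcast] at a4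
    constructor
    · change euclNorm x + euclNorm (latticeCast k - x) ≤ σ + 8
      linarith
    · change ¬ euclNorm x + euclNorm (latticeCast k - x) ≤ σ - 8
      linarith
  have hvol := (measure_mono hsub).trans
    (volume_ellipsoid_shell_le (by norm_num : (0 : ℝ) < 8) hσ.2 hσ.1)
  rw [measure_biUnion_finset (fun m _ n _ h => disjoint_unitCube h)
    (fun n _ => measurableSet_unitCube n), Finset.sum_congr rfl fun n _ => volume_unitCube n,
    Finset.sum_const, nsmul_one, ← ENNReal.ofReal_natCast,
    ENNReal.ofReal_le_ofReal_iff (by positivity)] at hvol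
  nlinarith [sq_nonneg N]

lemma exp_neg_sq_div_le_geometric (x : ℝ) :
    Real.exp (-x ^ 2 / 4) ≤ Real.exp 2 * Real.exp (-1) ^ ⌊|x|⌋₊ := by
  rw [← Real.exp_nat_mul, ← Real.exp_add, Real.exp_le_exp]
  have h := Nat.floor_le (abs_nonneg x)
  nlinarith [sq_abs x, sq_nonneg (|x| - 2)]

/-- If at most `M` of the numbers `φ i` lie within distance one of any given point, then the
Gaussian sums `∑ exp (-(φ i - σ)² / 4)` are bounded by a multiple of `M`. -/
lemma sum_exp_neg_sq_le {ι : Type*} (s : Finset ι) (φ : ι → ℝ) (M : ℝ)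
    (hM : ∀ σ : ℝ, ((s.filter fun i => |φ i - σ| ≤ 1).card : ℝ) ≤ M) (σ : ℝ) :
    ∑ i ∈ s, Real.exp (-(φ i - σ) ^ 2 / 4)
      ≤ 2 * Real.exp 2 * (1 - Real.exp (-1))⁻¹ * M := by
  classical
  have he : Real.exp (-1) < 1 := by simp
  have hM0 : 0 ≤ M := (Nat.cast_nonneg _).trans (hM 0)
  set L := s.sup fun i => ⌊|φ i - σ|⌋₊
  have hmaps : ∀ i ∈ s, ⌊|φ i - σ|⌋₊ ∈ Finset.range (L + 1) := fun i hi =>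
    Finset.mem_range.2 (Nat.lt_succ_of_le (Finset.le_sup (f := fun i => ⌊|φ i - σ|⌋₊) hi))
  rw [← Finset.sum_fiberwise_of_maps_to hmaps]
  have hfib : ∀ j ∈ Finset.range (L + 1),
      ∑ i ∈ s.filter (fun i => ⌊|φ i - σ|⌋₊ = j), Real.exp (-(φ i - σ) ^ 2 / 4)
        ≤ 2 * Real.exp 2 * M * Real.exp (-1) ^ j := fun j _ => by
    have hcard : ((s.filter fun i => ⌊|φ i - σ|⌋₊ = j).card : ℝ) ≤ M + M := by
      refine le_trans ?_ (add_le_add (hM (σ + j)) (hM (σ - j)))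
      rw [← Nat.cast_add]
      refine Nat.cast_le.2 (le_trans (Finset.card_le_card ?_) (Finset.card_union_le _ _))
      intro i hi
      simp only [Finset.mem_filter, Finset.mem_union] at hi ⊢
      have h1 := Nat.floor_le (abs_nonneg (φ i - σ))
      have h2 := Nat.lt_floor_add_one |φ i - σ|
      rw [hi.2] at h1 h2
      rcases abs_cases (φ i - σ) with h | h
      · exact Or.inl ⟨hi.1, abs_le.2 ⟨by linarith, by linarith⟩⟩
      · exact Or.inr ⟨hi.1, abs_le.2 ⟨by linarith, by linarith⟩⟩
    calc ∑ i ∈ s.filter (fun i => ⌊|φ i - σ|⌋₊ = j), Real.exp (-(φ i - σ) ^ 2 / 4)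
        ≤ ∑ i ∈ s.filter (fun i => ⌊|φ i - σ|⌋₊ = j), Real.exp 2 * Real.exp (-1) ^ j := by
          refine Finset.sum_le_sum fun i hi => ?_
          have := exp_neg_sq_div_le_geometric (φ i - σ)
          rwa [(Finset.mem_filter.1 hi).2] at this
      _ = (s.filter fun i => ⌊|φ i - σ|⌋₊ = j).card * (Real.exp 2 * Real.exp (-1) ^ j) := by
          rw [Finset.sum_const, nsmul_eq_mul]
      _ ≤ (M + M) * (Real.exp 2 * Real.exp (-1) ^ j) :=
          mul_le_mul_of_nonneg_right hcard (by positivity)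
      _ = _ := by ring
  refine (Finset.sum_le_sum hfib).trans ?_
  rw [← Finset.mul_sum]
  have hgeo : ∑ j ∈ Finset.range (L + 1), Real.exp (-1) ^ j ≤ (1 - Real.exp (-1))⁻¹ := by
    rw [← tsum_geometric_of_lt_one (Real.exp_nonneg _) he]
    exact (summable_geometric_of_lt_one (Real.exp_nonneg _) he).sum_le_tsum _
      fun _ _ => by positivity
  calc _ ≤ 2 * Real.exp 2 * M * (1 - Real.exp (-1))⁻¹ :=
        mul_le_mul_of_nonneg_left hgeo (by positivity)
    _ = _ := by ring

/-- The space-time character `exp (i (n·x + tθ))`. -/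
noncomputable def waveMode (n : Fin 3 → ℤ) (θ : ℝ) (z : ℝ × (Fin 3 → ℝ)) : ℂ :=
  Complex.exp (Complex.I * ((dotZ n z.2 + z.1 * θ : ℝ) : ℂ))

lemma continuous_waveMode (n : Fin 3 → ℤ) (θ : ℝ) : Continuous (waveMode n θ) := by
  unfold waveMode dotZ
  fun_prop

lemma norm_waveMode (n : Fin 3 → ℤ) (θ : ℝ) (z : ℝ × (Fin 3 → ℝ)) : ‖waveMode n θ z‖ = 1 := by
  rw [waveMode, mul_comm, Complex.norm_exp_ofReal_mul_I]

lemma waveMode_mul (m n : Fin 3 → ℤ) (θ η : ℝ) (z : ℝ × (Fin 3 → ℝ)) :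
    waveMode m θ z * waveMode n η z = waveMode (m + n) (θ + η) z := by
  simp only [waveMode, dotZ, ← Complex.exp_add, Fin.sum_univ_three, Pi.add_apply]
  congr 1
  push_cast
  ring

lemma waveMode_mul_conj (m n : Fin 3 → ℤ) (θ η : ℝ) (z : ℝ × (Fin 3 → ℝ)) :
    waveMode m θ z * (starRingEnd ℂ) (waveMode n η z) = waveMode (m - n) (θ - η) z := by
  simp only [waveMode, dotZ, ← Complex.exp_conj, ← Complex.exp_add, Fin.sum_univ_three,
    Pi.sub_apply, map_mul, Complex.conj_I, Complex.conj_ofReal]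
  congr 1
  push_cast
  ring

lemma integral_exp_int_mul (m : ℤ) :
    ∫ x in Set.Ico (0 : ℝ) (2 * Real.pi), Complex.exp (Complex.I * ((m * x : ℝ) : ℂ))
      = if m = 0 then (2 * Real.pi : ℂ) else 0 := by
  rw [integral_Ico_eq_integral_Ioc, ← intervalIntegral.integral_of_le (by positivity)]
  split_ifs with h
  · simp [h]
  · have hc : Complex.I * (m : ℂ) ≠ 0 := mul_ne_zero Complex.I_ne_zero (by exact_mod_cast h)
    have := integral_exp_mul_complex (a := 0) (b := 2 * Real.pi) hc
    simp only [Complex.ofReal_mul, Complex.ofReal_intCast, ← mul_assoc]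
    rw [this]
    have e : Complex.exp (Complex.I * m * ((2 * Real.pi : ℝ) : ℂ)) = 1 := by
      rw [Complex.exp_eq_one_iff]
      exact ⟨m, by push_cast; ring⟩
    rw [e]
    simp

lemma restrict_cube :
    (volume : Measure (Fin 3 → ℝ)).restrict cube
      = Measure.pi fun _ => volume.restrict (Set.Ico (0 : ℝ) (2 * Real.pi)) := by
  rw [cube, volume_pi, Measure.restrict_pi_pi]

instance isFiniteMeasure_restrict_cube :
    IsFiniteMeasure ((volume : Measure (Fin 3 → ℝ)).restrict cube) := by
  rw [restrict_cube]
  infer_instance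

lemma integral_exp_dotZ (n : Fin 3 → ℤ) :
    ∫ x in cube, Complex.exp (Complex.I * ((dotZ n x : ℝ) : ℂ))
      = if n = 0 then (2 * Real.pi : ℂ) ^ 3 else 0 := by
  have h : ∀ x, Complex.exp (Complex.I * ((dotZ n x : ℝ) : ℂ))
      = ∏ i, (fun (i : Fin 3) (y : ℝ) => Complex.exp (Complex.I * ((n i * y : ℝ) : ℂ))) i (x i) :=
    fun x => by
      rw [← Complex.exp_sum, ← Finset.mul_sum, dotZ, Complex.ofReal_sum]
  rw [restrict_cube]
  rw [integral_congr_ae (Filter.Eventually.of_forall h)]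
  rw [integral_fintype_prod_eq_prod
    (fun (i : Fin 3) (y : ℝ) => Complex.exp (Complex.I * ((n i * y : ℝ) : ℂ)))]
  simp_rw [integral_exp_int_mul]
  split_ifs with h0
  · simp [h0]
  · obtain ⟨i, hi⟩ := Function.ne_iff.1 h0
    exact Finset.prod_eq_zero (Finset.mem_univ i) (if_neg hi)

/-- Lebesgue measure on `ℝ × T³`. -/
noncomputable def stripMeasure : Measure (ℝ × (Fin 3 → ℝ)) :=
  volume.prod (volume.restrict cube)

lemma integrable_gaussian_strip :
    Integrable (fun z : ℝ × (Fin 3 → ℝ) => Real.exp (-z.1 ^ 2)) stripMeasure := by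
  have h := (integrable_exp_neg_mul_sq (b := 1) one_pos).mul_prod
    (integrable_const (1 : ℝ) (μ := (volume : Measure (Fin 3 → ℝ)).restrict cube))
  simpa [stripMeasure] using h

lemma integrable_gaussian_mul_waveMode (n : Fin 3 → ℤ) (θ : ℝ) :
    Integrable (fun z => (Real.exp (-z.1 ^ 2) : ℂ) * waveMode n θ z) stripMeasure := by
  refine (integrable_gaussian_strip.ofReal (𝕜 := ℂ)).mul_bdd (c := 1)
    (continuous_waveMode n θ).aestronglyMeasurable (Filter.Eventually.of_forall fun z => ?_)
  rw [norm_waveMode]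

lemma integral_gaussian_mul_waveMode (n : Fin 3 → ℤ) (θ : ℝ) :
    ∫ z, (Real.exp (-z.1 ^ 2) : ℂ) * waveMode n θ z ∂stripMeasure
      = (Real.pi : ℂ) ^ (1 / 2 : ℂ) * Real.exp (-θ ^ 2 / 4)
        * if n = 0 then (2 * Real.pi : ℂ) ^ 3 else 0 := by
  have h : ∀ z : ℝ × (Fin 3 → ℝ), (Real.exp (-z.1 ^ 2) : ℂ) * waveMode n θ z
      = (Complex.exp (Complex.I * θ * z.1) * Complex.exp (-1 * z.1 ^ 2))
        * Complex.exp (Complex.I * ((dotZ n z.2 : ℝ) : ℂ)) := fun z => by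
    rw [waveMode, Complex.ofReal_exp, ← Complex.exp_add, ← Complex.exp_add, ← Complex.exp_add]
    congr 1
    push_cast
    ring
  simp_rw [h, stripMeasure]
  rw [integral_prod_mul (fun t : ℝ => Complex.exp (Complex.I * θ * t) * Complex.exp (-1 * t ^ 2))
    (fun x => Complex.exp (Complex.I * ((dotZ n x : ℝ) : ℂ))), integral_exp_dotZ,
    fourierIntegral_gaussian (by simp)]
  congr 2
  · simp
  · push_cast
    congr 1
    ring

lemma norm_integral_gaussian_mul_waveMode_le (n : Fin 3 → ℤ) (θ : ℝ) :
    ‖∫ z, (Real.exp (-z.1 ^ 2) : ℂ) * waveMode n θ z ∂stripMeasure‖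
      ≤ ‖(Real.pi : ℂ) ^ (1 / 2 : ℂ)‖ * (2 * Real.pi) ^ 3 *
        if n = 0 then Real.exp (-θ ^ 2 / 4) else 0 := by
  rw [integral_gaussian_mul_waveMode]
  split_ifs
  · rw [norm_mul, norm_mul, norm_pow, norm_mul, Complex.norm_real, Complex.norm_real,
      Complex.norm_two, Real.norm_of_nonneg (Real.exp_nonneg _),
      Real.norm_of_nonneg Real.pi_nonneg]
    exact le_of_eq (by ring)
  · simp

lemma gaussian_mul_norm_sq_eq {ι : Type*} (P : Finset ι) (b : ι → ℂ) (k : ι → Fin 3 → ℤ)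
    (θ : ι → ℝ) (z : ℝ × (Fin 3 → ℝ)) :
    ((Real.exp (-z.1 ^ 2) * ‖∑ p ∈ P, b p * waveMode (k p) (θ p) z‖ ^ 2 : ℝ) : ℂ)
      = ∑ p ∈ P, ∑ q ∈ P, b p * (starRingEnd ℂ) (b q) *
        ((Real.exp (-z.1 ^ 2) : ℂ) * waveMode (k p - k q) (θ p - θ q) z) := by
  push_cast
  rw [← Complex.mul_conj', map_sum, Finset.sum_mul_sum, Finset.mul_sum]
  refine Finset.sum_congr rfl fun p _ => ?_
  rw [Finset.mul_sum]
  refine Finset.sum_congr rfl fun q _ => ?_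
  rw [← waveMode_mul_conj, map_mul]
  ring

lemma integrable_gaussian_mul_norm_sq {ι : Type*} (P : Finset ι) (b : ι → ℂ)
    (k : ι → Fin 3 → ℤ) (θ : ι → ℝ) :
    Integrable (fun z => Real.exp (-z.1 ^ 2) * ‖∑ p ∈ P, b p * waveMode (k p) (θ p) z‖ ^ 2)
      stripMeasure := by
  refine integrable_gaussian_strip.mul_bdd (c := (∑ p ∈ P, ‖b p‖) ^ 2) ?_
    (Filter.Eventually.of_forall fun z => ?_)
  · refine Continuous.aestronglyMeasurable ?_
    have := fun p => continuous_waveMode (k p) (θ p)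
    fun_prop
  · rw [norm_pow, norm_norm]
    refine pow_le_pow_left₀ (norm_nonneg _) ((norm_sum_le _ _).trans (le_of_eq ?_)) 2
    simp [norm_waveMode]

lemma integral_gaussian_mul_norm_sq_le {ι : Type*} (P : Finset ι) (b : ι → ℂ)
    (k : ι → Fin 3 → ℤ) (θ : ι → ℝ) :
    ∫ z, Real.exp (-z.1 ^ 2) * ‖∑ p ∈ P, b p * waveMode (k p) (θ p) z‖ ^ 2 ∂stripMeasure
      ≤ ‖(Real.pi : ℂ) ^ (1 / 2 : ℂ)‖ * (2 * Real.pi) ^ 3 * ∑ p ∈ P, ∑ q ∈ P, ‖b p‖ * ‖b q‖ *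
        if k p = k q then Real.exp (-(θ p - θ q) ^ 2 / 4) else 0 := by
  refine (Real.le_norm_self _).trans ?_
  rw [← Complex.norm_real, ← integral_complex_ofReal]
  simp_rw [gaussian_mul_norm_sq_eq]
  have hint : ∀ p q, Integrable (fun z => b p * (starRingEnd ℂ) (b q) *
      ((Real.exp (-z.1 ^ 2) : ℂ) * waveMode (k p - k q) (θ p - θ q) z)) stripMeasure :=
    fun p q => (integrable_gaussian_mul_waveMode _ _).const_mul _
  rw [integral_finsetSum _ fun p _ => integrable_finsetSum _ fun q _ => hint p q,
    Finset.mul_sum]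
  refine (norm_sum_le _ _).trans (Finset.sum_le_sum fun p _ => ?_)
  rw [integral_finsetSum _ fun q _ => hint p q, Finset.mul_sum]
  refine (norm_sum_le _ _).trans (Finset.sum_le_sum fun q _ => ?_)
  rw [integral_const_mul, norm_mul, norm_mul, RCLike.norm_conj]
  have := norm_integral_gaussian_mul_waveMode_le (k p - k q) (θ p - θ q)
  simp only [sub_eq_zero] at this
  calc _ ≤ ‖b p‖ * ‖b q‖ * _ := mul_le_mul_of_nonneg_left this (by positivity)
    _ = _ := by ring

lemma sum_sum_mul_le_of_schur {ι : Type*} (P : Finset ι) (K : ι → ι → ℝ) (b : ι → ℝ) (A : ℝ)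
    (hK : ∀ p q, 0 ≤ K p q) (hsymm : ∀ p q, K p q = K q p)
    (hA : ∀ p ∈ P, ∑ q ∈ P, K p q ≤ A) :
    ∑ p ∈ P, ∑ q ∈ P, b p * b q * K p q ≤ A * ∑ p ∈ P, b p ^ 2 := by
  have h1 : ∑ p ∈ P, ∑ q ∈ P, b p * b q * K p q
      ≤ ∑ p ∈ P, ∑ q ∈ P, (b p ^ 2 * K p q / 2 + b q ^ 2 * K q p / 2) := by
    refine Finset.sum_le_sum fun p _ => Finset.sum_le_sum fun q _ => ?_
    rw [hsymm q p]
    nlinarith [mul_nonneg (hK p q) (sq_nonneg (b p - b q))]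
  have h2 : ∑ p ∈ P, ∑ q ∈ P, (b p ^ 2 * K p q / 2 + b q ^ 2 * K q p / 2)
      = ∑ p ∈ P, b p ^ 2 * ∑ q ∈ P, K p q := by
    simp_rw [Finset.sum_add_distrib]
    rw [Finset.sum_comm (f := fun p q => b q ^ 2 * K q p / 2), ← Finset.sum_add_distrib]
    refine Finset.sum_congr rfl fun p _ => ?_
    rw [Finset.mul_sum, ← Finset.sum_add_distrib]
    exact Finset.sum_congr rfl fun q _ => by ring
  rw [h2] at h1
  rw [Finset.mul_sum]
  refine h1.trans (Finset.sum_le_sum fun p hp => ?_)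
  rw [mul_comm A]
  exact mul_le_mul_of_nonneg_left (hA p hp) (sq_nonneg _)

/-- Row sums of the interaction kernel for products of two half-waves with frequencies in `S_N`. -/
lemma sum_interaction_le :
    ∃ A > (0 : ℝ), ∀ N : ℝ, 1 ≤ N → ∀ ς : ℝ, ς ^ 2 = 1 → ∀ p : (Fin 3 → ℤ) × (Fin 3 → ℤ),
      ∑ q ∈ annulus N ×ˢ annulus N, (if p.1 + p.2 = q.1 + q.2 then
        Real.exp (-(ς * jbZ p.1 + ς * jbZ p.2 - (ς * jbZ q.1 + ς * jbZ q.2)) ^ 2 / 4) else 0)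
        ≤ A * N ^ 2 := by
  classical
  obtain ⟨C, hC, hcard⟩ := card_shell_le
  have he : 0 < 1 - Real.exp (-1) := by simp
  refine ⟨2 * Real.exp 2 * (1 - Real.exp (-1))⁻¹ * C, by positivity, fun N hN ς hς p => ?_⟩
  set σ := jbZ p.1 + jbZ p.2 with hσ
  set k := p.1 + p.2 with hk
  have hrw : ∑ q ∈ annulus N ×ˢ annulus N, (if k = q.1 + q.2 then
        Real.exp (-(ς * jbZ p.1 + ς * jbZ p.2 - (ς * jbZ q.1 + ς * jbZ q.2)) ^ 2 / 4) else 0)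
      = ∑ n ∈ (annulus N).filter (fun n => k - n ∈ annulus N),
        Real.exp (-(jbZ n + jbZ (k - n) - σ) ^ 2 / 4) := by
    rw [Finset.sum_product, Finset.sum_filter]
    refine Finset.sum_congr rfl fun n _ => ?_
    have h1 : ∀ m : Fin 3 → ℤ, k = n + m ↔ k - n = m := fun m => by
      rw [sub_eq_iff_eq_add, add_comm]
    simp only [h1]
    rw [Finset.sum_ite_eq]
    congr 2
    have : (ς * jbZ p.1 + ς * jbZ p.2 - (ς * jbZ n + ς * jbZ (k - n))) ^ 2
        = ς ^ 2 * (jbZ n + jbZ (k - n) - σ) ^ 2 := by rw [hσ]; ring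
    rw [this, hς, one_mul]
  rw [hrw]
  refine (sum_exp_neg_sq_le _ _ (C * N ^ 2) (fun τ => ?_) σ).trans (le_of_eq (by ring))
  rw [Finset.filter_filter]
  convert! hcard N hN k τ

lemma setLIntegral_strip_le (a b : ℝ) (f : ℝ × (Fin 3 → ℝ) → ℝ) (hf : ∀ z, 0 ≤ f z)
    (hint : Integrable (fun z => Real.exp (-z.1 ^ 2) * f z) stripMeasure) :
    ∫⁻ z in Set.Icc a b ×ˢ cube, ENNReal.ofReal (f z)
      ≤ ENNReal.ofReal (Real.exp (max |a| |b| ^ 2) *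
        ∫ z, Real.exp (-z.1 ^ 2) * f z ∂stripMeasure) := by
  have hμ : (volume : Measure (ℝ × (Fin 3 → ℝ))).restrict (Set.Icc a b ×ˢ cube)
      = stripMeasure.restrict (Set.Icc a b ×ˢ Set.univ) := by
    rw [stripMeasure, ← Measure.prod_restrict, Measure.restrict_univ, Measure.prod_restrict,
      Measure.volume_eq_prod]
  rw [hμ, ← integral_const_mul, ofReal_integral_eq_lintegral_ofReal (hint.const_mul _)
    (Filter.Eventually.of_forall fun z => mul_nonneg (Real.exp_nonneg _)
      (mul_nonneg (Real.exp_nonneg _) (hf z)))]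
  refine (setLIntegral_mono' (measurableSet_Icc.prod MeasurableSet.univ) fun z hz => ?_).trans
    (setLIntegral_le_lintegral _ _)
  refine ENNReal.ofReal_le_ofReal ?_
  rw [← mul_assoc, ← Real.exp_add]
  refine le_mul_of_one_le_left (hf z) (Real.one_le_exp ?_)
  have h1 : |z.1| ≤ max |a| |b| := abs_le_max_abs_abs hz.1.1 hz.1.2
  have h2 := pow_le_pow_left₀ (abs_nonneg _) h1 2
  rw [sq_abs] at h2
  linarith

/-- The free `L⁴` Strichartz estimate for half-waves on `T³` with frequencies in `S_N`. -/
lemma lintegral_halfWave_pow_four_le (a b : ℝ) :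
    ∃ C > (0 : ℝ), ∀ N : ℝ, 1 ≤ N → ∀ ς : ℝ, ς ^ 2 = 1 → ∀ α : (Fin 3 → ℤ) → ℂ,
      ∫⁻ z in Set.Icc a b ×ˢ cube, ‖∑ n ∈ annulus N, α n * waveMode n (ς * jbZ n) z‖ₑ ^ 4
        ≤ ENNReal.ofReal (C * N ^ 2 * (∑ n ∈ annulus N, ‖α n‖ ^ 2) ^ 2) := by
  obtain ⟨A, hA, hsum⟩ := sum_interaction_le
  have hπ : 0 < ‖(Real.pi : ℂ) ^ (1 / 2 : ℂ)‖ := by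
    rw [norm_pos_iff, Complex.cpow_ne_zero_iff]
    exact Or.inl (by exact_mod_cast Real.pi_ne_zero)
  have hπ2 := Real.pi_pos
  refine ⟨Real.exp (max |a| |b| ^ 2) * (‖(Real.pi : ℂ) ^ (1 / 2 : ℂ)‖ * (2 * Real.pi) ^ 3 * A),
    by positivity, fun N hN ς hς α => ?_⟩
  set S := annulus N
  let β : (Fin 3 → ℤ) × (Fin 3 → ℤ) → ℂ := fun p => α p.1 * α p.2
  let k : (Fin 3 → ℤ) × (Fin 3 → ℤ) → Fin 3 → ℤ := fun p => p.1 + p.2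
  let θ : (Fin 3 → ℤ) × (Fin 3 → ℤ) → ℝ := fun p => ς * jbZ p.1 + ς * jbZ p.2
  have hsq : ∀ z, (∑ n ∈ S, α n * waveMode n (ς * jbZ n) z) ^ 2
      = ∑ p ∈ S ×ˢ S, β p * waveMode (k p) (θ p) z := fun z => by
    rw [sq, Finset.sum_mul_sum, Finset.sum_product]
    refine Finset.sum_congr rfl fun m _ => Finset.sum_congr rfl fun n _ => ?_
    simp only [β, k, θ, ← waveMode_mul]
    ring
  have hpow : ∀ z, ‖∑ n ∈ S, α n * waveMode n (ς * jbZ n) z‖ₑ ^ 4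
      = ENNReal.ofReal (‖∑ p ∈ S ×ˢ S, β p * waveMode (k p) (θ p) z‖ ^ 2) := fun z => by
    rw [← hsq, norm_pow, ← pow_mul, ENNReal.ofReal_pow (norm_nonneg _), ofReal_norm]
  simp_rw [hpow]
  refine (setLIntegral_strip_le a b _ (fun z => sq_nonneg _)
    (integrable_gaussian_mul_norm_sq _ _ _ _)).trans (ENNReal.ofReal_le_ofReal ?_)
  have hschur := sum_sum_mul_le_of_schur (S ×ˢ S)
    (fun p q => if k p = k q then Real.exp (-(θ p - θ q) ^ 2 / 4) else 0) (fun p => ‖β p‖)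
    (A * N ^ 2) (fun p q => by split_ifs <;> positivity)
    (fun p q => by
      simp only [eq_comm (a := k p)]
      rw [← neg_sub (θ p), neg_sq])
    (fun p _ => hsum N hN ς hς p)
  have hβ : ∑ p ∈ S ×ˢ S, ‖β p‖ ^ 2 = (∑ n ∈ S, ‖α n‖ ^ 2) ^ 2 := by
    rw [sq (∑ n ∈ S, ‖α n‖ ^ 2), Finset.sum_mul_sum, Finset.sum_product]
    simp only [β, norm_mul, mul_pow]
  rw [hβ] at hschur
  have h := (integral_gaussian_mul_norm_sq_le (S ×ˢ S) β k θ).trans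
    (mul_le_mul_of_nonneg_left hschur (by positivity))
  refine (mul_le_mul_of_nonneg_left h (Real.exp_nonneg _)).trans (le_of_eq ?_)
  ring

open scoped ENNReal in
lemma lintegral_mul_sq_le {X : Type*} [MeasurableSpace X] (μ : Measure X) {f g : X → ℝ≥0∞}
    (hf : AEMeasurable f μ) (hg : AEMeasurable g μ) :
    (∫⁻ x, f x * g x ∂μ) ^ 2 ≤ (∫⁻ x, f x ^ 2 ∂μ) * ∫⁻ x, g x ^ 2 ∂μ := by
  have h := ENNReal.lintegral_mul_le_Lp_mul_Lq μ Real.HolderConjugate.two_two hf hg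
  simp only [Pi.mul_apply, ENNReal.rpow_two] at h
  refine (pow_le_pow_left₀ (by simp) h 2).trans (le_of_eq ?_)
  rw [mul_pow, ← ENNReal.rpow_two, ← ENNReal.rpow_two, ← ENNReal.rpow_mul, ← ENNReal.rpow_mul]
  norm_num

open scoped ENNReal in
/-- Minkowski's integral inequality in `L²`. -/
lemma lintegral_lintegral_sq_le {X Y : Type*} [MeasurableSpace X] [MeasurableSpace Y]
    (μ : Measure X) (ν : Measure Y) [SFinite μ] [SFinite ν] {G : Y → X → ℝ≥0∞}
    (hG : Measurable (Function.uncurry G)) {B : Y → ℝ≥0∞} (hB : Measurable B)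
    (h : ∀ y, ∫⁻ x, G y x ^ 2 ∂μ ≤ B y ^ 2) :
    ∫⁻ x, (∫⁻ y, G y x ∂ν) ^ 2 ∂μ ≤ (∫⁻ y, B y ∂ν) ^ 2 := by
  have hy : ∀ y, Measurable (G y) := fun y => hG.comp measurable_prodMk_left
  have hx : ∀ x, Measurable fun y => G y x := fun x => hG.comp measurable_prodMk_right
  have hcs : ∀ y y', ∫⁻ x, G y x * G y' x ∂μ ≤ B y * B y' := fun y y' => by
    rw [← ENNReal.pow_le_pow_left_iff two_ne_zero, mul_pow]
    exact (lintegral_mul_sq_le μ (hy y).aemeasurable (hy y').aemeasurable).trans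
      (mul_le_mul' (h y) (h y'))
  calc ∫⁻ x, (∫⁻ y, G y x ∂ν) ^ 2 ∂μ
      = ∫⁻ x, ∫⁻ p, G p.1 x * G p.2 x ∂(ν.prod ν) ∂μ := by
        refine lintegral_congr fun x => ?_
        rw [lintegral_prod_mul (hx x).aemeasurable (hx x).aemeasurable, sq]
    _ = ∫⁻ p, ∫⁻ x, G p.1 x * G p.2 x ∂μ ∂(ν.prod ν) := by
        refine lintegral_lintegral_swap (Measurable.aemeasurable ?_)
        exact (hG.comp ((measurable_fst.comp measurable_snd).prodMk measurable_fst)).mul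
          (hG.comp ((measurable_snd.comp measurable_snd).prodMk measurable_fst))
    _ ≤ ∫⁻ p, B p.1 * B p.2 ∂(ν.prod ν) := lintegral_mono fun p => hcs p.1 p.2
    _ = (∫⁻ y, B y ∂ν) ^ 2 := by
        rw [lintegral_prod_mul hB.aemeasurable hB.aemeasurable, sq]

lemma continuous_jbR_rpow (r : ℝ) : Continuous fun s => jbR s ^ r := by
  unfold jbR
  exact (by fun_prop : Continuous fun s : ℝ => Real.sqrt (1 + s ^ 2)).rpow_const
    fun s => Or.inl (Real.sqrt_pos.2 (by positivity)).ne'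

lemma jbR_rpow_nonneg (r s : ℝ) : 0 ≤ jbR s ^ r := Real.rpow_nonneg (Real.sqrt_nonneg _) _

lemma integrable_jbR_rpow_sq {ε : ℝ} (hε : 0 < ε) :
    Integrable fun s => (jbR s ^ (-(1 / 2 + ε))) ^ 2 := by
  have h := integrable_rpow_neg_one_add_norm_sq (E := ℝ) (μ := volume) (r := 1 + 2 * ε)
    (by simp [hε])
  refine h.congr (Filter.Eventually.of_forall fun s => ?_)
  have h1 : 0 ≤ 1 + s ^ 2 := by positivity
  simp only [jbR, Real.norm_eq_abs, sq_abs]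
  rw [Real.sqrt_eq_rpow, ← Real.rpow_mul h1, ← Real.rpow_mul_natCast h1]
  congr 1
  push_cast
  ring

/-- The `L⁴` estimate for weighted superpositions of half-waves with modulation `s`. -/
lemma lintegral_superposition_pow_four_le (a b : ℝ) {ε : ℝ} (hε : 0 < ε) :
    ∃ C > (0 : ℝ), ∀ N : ℝ, 1 ≤ N → ∀ ς : ℝ, ς ^ 2 = 1 → ∀ α : (Fin 3 → ℤ) → ℝ → ℂ,
      (∀ n ∈ annulus N, Measurable (α n)) →
      (∀ n ∈ annulus N, Integrable fun s => ‖α n s‖ ^ 2) →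
      ∫⁻ z in Set.Icc a b ×ˢ cube, (∫⁻ s, ENNReal.ofReal (jbR s ^ (-(1 / 2 + ε))) *
          ‖∑ n ∈ annulus N, α n s * waveMode n (ς * jbZ n) z‖ₑ) ^ 4
        ≤ ENNReal.ofReal (C * N ^ 2 * (∑ n ∈ annulus N, ∫ s, ‖α n s‖ ^ 2) ^ 2) := by
  obtain ⟨C, hC, hfree⟩ := lintegral_halfWave_pow_four_le a b
  set K := ∫ s, (jbR s ^ (-(1 / 2 + ε))) ^ 2 with hK
  have hK0 : 0 ≤ K := integral_nonneg fun s => sq_nonneg _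
  refine ⟨C * K ^ 2 + 1, by positivity, fun N hN ς hς α hα hint => ?_⟩
  set S := annulus N
  let F : ℝ → ℝ × (Fin 3 → ℝ) → ℂ := fun s z => ∑ n ∈ S, α n s * waveMode n (ς * jbZ n) z
  have hF : Measurable (Function.uncurry F) := by
    refine Finset.measurable_fun_sum _ fun n hn => ?_
    exact ((hα n hn).comp measurable_fst).mul
      ((continuous_waveMode n (ς * jbZ n)).measurable.comp measurable_snd)
  have hG : Measurable (Function.uncurry fun s z => ‖F s z‖ₑ ^ 2) := hF.enorm.pow_const 2
  let B : ℝ → ENNReal := fun s => ENNReal.ofReal (Real.sqrt C * N * ∑ n ∈ S, ‖α n s‖ ^ 2)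
  have hB : Measurable B := by
    refine ENNReal.measurable_ofReal.comp (measurable_const.mul ?_)
    exact Finset.measurable_fun_sum _ fun n hn => (hα n hn).norm.pow_const 2
  have hw : ∫⁻ s, ENNReal.ofReal (jbR s ^ (-(1 / 2 + ε))) ^ 2 = ENNReal.ofReal K := by
    rw [hK, ofReal_integral_eq_lintegral_ofReal (integrable_jbR_rpow_sq hε)
      (Filter.Eventually.of_forall fun s => sq_nonneg _)]
    exact lintegral_congr fun s => (ENNReal.ofReal_pow (jbR_rpow_nonneg _ _) 2).symm
  have hpt : ∀ z, (∫⁻ s, ENNReal.ofReal (jbR s ^ (-(1 / 2 + ε))) * ‖F s z‖ₑ) ^ 4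
      ≤ ENNReal.ofReal K ^ 2 * (∫⁻ s, ‖F s z‖ₑ ^ 2) ^ 2 := fun z => by
    have h := lintegral_mul_sq_le volume
      (f := fun s => ENNReal.ofReal (jbR s ^ (-(1 / 2 + ε)))) (g := fun s => ‖F s z‖ₑ)
      (continuous_jbR_rpow _).measurable.ennreal_ofReal.aemeasurable
      (hF.comp measurable_prodMk_right).enorm.aemeasurable
    rw [hw] at h
    rw [← mul_pow, show 4 = 2 * 2 from rfl, pow_mul]
    exact pow_le_pow_left₀ (by simp) h 2
  have hmink := lintegral_lintegral_sq_le (volume.restrict (Set.Icc a b ×ˢ cube)) volume hG hB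
    fun s => by
      simp only [← pow_mul]
      refine (hfree N hN ς hς fun n => α n s).trans (le_of_eq ?_)
      simp only [B]
      rw [← ENNReal.ofReal_pow (mul_nonneg (mul_nonneg (Real.sqrt_nonneg _) (by linarith))
        (Finset.sum_nonneg fun _ _ => sq_nonneg _)), mul_pow, mul_pow, Real.sq_sqrt hC.le]
  have hBint : ∫⁻ s, B s = ENNReal.ofReal (Real.sqrt C * N * ∑ n ∈ S, ∫ s, ‖α n s‖ ^ 2) := by
    rw [← integral_finsetSum _ hint, ← integral_const_mul,
      ofReal_integral_eq_lintegral_ofReal ((integrable_finsetSum _ hint).const_mul _)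
        (Filter.Eventually.of_forall fun s => mul_nonneg
          (mul_nonneg (Real.sqrt_nonneg _) (by linarith))
          (Finset.sum_nonneg fun _ _ => sq_nonneg _))]
  have hE : 0 ≤ ∑ n ∈ S, ∫ s, ‖α n s‖ ^ 2 :=
    Finset.sum_nonneg fun n _ => integral_nonneg fun s => sq_nonneg _
  rw [hBint, ← ENNReal.ofReal_pow (mul_nonneg (mul_nonneg (Real.sqrt_nonneg _) (by linarith)) hE),
    mul_pow, mul_pow, Real.sq_sqrt hC.le] at hmink
  refine (lintegral_mono hpt).trans ?_
  rw [lintegral_const_mul' _ _ (by finiteness)]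
  refine (mul_le_mul_right hmink _).trans ?_
  rw [← ENNReal.ofReal_pow hK0, ← ENNReal.ofReal_mul (by positivity)]
  refine ENNReal.ofReal_le_ofReal ?_
  have : 0 ≤ N ^ 2 * (∑ n ∈ S, ∫ s, ‖α n s‖ ^ 2) ^ 2 := by positivity
  nlinarith

lemma integral_comp_sign_mul_add {E : Type*} [NormedAddCommGroup E] [NormedSpace ℝ E]
    (h : ℝ → E) {ς : ℝ} (hς : ς = 1 ∨ ς = -1) (ω : ℝ) :
    ∫ s, h (ς * (s + ω)) = ∫ s, h s := by
  rw [integral_add_right_eq_self (fun s => h (ς * s)) ω]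
  rcases hς with rfl | rfl
  · simp
  · simpa using integral_neg_eq_self h volume

lemma integrable_comp_sign_mul_add_iff {E : Type*} [NormedAddCommGroup E] {h : ℝ → E} {ς : ℝ}
    (hς : ς = 1 ∨ ς = -1) (ω : ℝ) :
    Integrable (fun s => h (ς * (s + ω))) ↔ Integrable h := by
  have h0 : ς ≠ 0 := by rcases hς with rfl | rfl <;> norm_num
  constructor
  · intro hi
    have := (hi.comp_sub_right ω).comp_mul_left' (inv_ne_zero h0)
    simpa [mul_inv_cancel_left₀ h0] using this
  · intro hi
    exact (hi.comp_mul_left' h0).comp_add_right ω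

/-- The integrand of the Fourier extension formula for `g`. -/
noncomputable def extensionIntegrand (ε : ℝ) (c : (Fin 3 → ℤ) → ℝ → ℂ) (z : ℝ × (Fin 3 → ℝ))
    (n : Fin 3 → ℤ) (τ : ℝ) : ℂ :=
  c n τ * ((jbR (|τ| - jbZ n) ^ (-(1/2 + ε)) : ℝ) : ℂ) *
    Complex.exp (Complex.I * ((dotZ n z.2 + z.1 * τ : ℝ) : ℂ))

lemma indicator_extensionIntegrand (ε : ℝ) (c : (Fin 3 → ℤ) → ℝ → ℂ) (z : ℝ × (Fin 3 → ℝ))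
    (n : Fin 3 → ℤ) {ς : ℝ} (hς : ς = 1 ∨ ς = -1) {T : Set ℝ} (hT : ∀ τ ∈ T, |τ| = ς * τ)
    (s : ℝ) :
    T.indicator (extensionIntegrand ε c z n) (ς * (s + jbZ n))
      = (((jbR s ^ (-(1 / 2 + ε)) : ℝ) : ℂ) * Complex.exp ((z.1 * ς * s : ℝ) * Complex.I)) *
        (T.indicator (c n) (ς * (s + jbZ n)) * waveMode n (ς * jbZ n) z) := by
  by_cases h : ς * (s + jbZ n) ∈ T
  · have hς2 : ς * ς = 1 := by rcases hς with rfl | rfl <;> norm_num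
    have habs : |ς * (s + jbZ n)| - jbZ n = s := by
      rw [hT _ h, ← mul_assoc, hς2]
      ring
    have hexp : Complex.exp (Complex.I * ((dotZ n z.2 + z.1 * (ς * (s + jbZ n)) : ℝ) : ℂ))
        = Complex.exp ((z.1 * ς * s : ℝ) * Complex.I) * waveMode n (ς * jbZ n) z := by
      rw [waveMode, ← Complex.exp_add]
      congr 1
      push_cast
      ring
    rw [Set.indicator_of_mem h, Set.indicator_of_mem h, extensionIntegrand, habs, hexp]
    ring
  · rw [Set.indicator_of_notMem h, Set.indicator_of_notMem h]
    simp

section Pieces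

variable {ε : ℝ} {c : (Fin 3 → ℤ) → ℝ → ℂ} {n : Fin 3 → ℤ} {ς : ℝ} {T : Set ℝ}

lemma measurable_piece (hT : MeasurableSet T) (hc : Measurable (c n)) (ς : ℝ) :
    Measurable fun s => T.indicator (c n) (ς * (s + jbZ n)) :=
  (hc.indicator hT).comp (by fun_prop)

lemma norm_piece_sq (s : ℝ) :
    ‖T.indicator (c n) s‖ ^ 2 = T.indicator (fun τ => ‖c n τ‖ ^ 2) s := by
  by_cases h : s ∈ T <;> simp [h]

lemma integrable_piece_sq (hT : MeasurableSet T) (hint : Integrable fun τ => ‖c n τ‖ ^ 2)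
    (hς : ς = 1 ∨ ς = -1) :
    Integrable fun s => ‖T.indicator (c n) (ς * (s + jbZ n))‖ ^ 2 := by
  simp_rw [norm_piece_sq]
  exact (integrable_comp_sign_mul_add_iff hς (jbZ n)).2 (hint.indicator hT)

lemma integral_piece_sq_le (hT : MeasurableSet T) (hint : Integrable fun τ => ‖c n τ‖ ^ 2)
    (hς : ς = 1 ∨ ς = -1) :
    ∫ s, ‖T.indicator (c n) (ς * (s + jbZ n))‖ ^ 2 ≤ ∫ τ, ‖c n τ‖ ^ 2 := by
  simp_rw [norm_piece_sq]
  rw [integral_comp_sign_mul_add (T.indicator fun τ => ‖c n τ‖ ^ 2) hς, integral_indicator hT]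
  exact setIntegral_le_integral hint (Filter.Eventually.of_forall fun τ => sq_nonneg _)

lemma integrable_indicator_extensionIntegrand (hε : 0 < ε) (hT : MeasurableSet T)
    (hTς : ∀ τ ∈ T, |τ| = ς * τ) (hς : ς = 1 ∨ ς = -1) (hc : Measurable (c n))
    (hint : Integrable fun τ => ‖c n τ‖ ^ 2) (z : ℝ × (Fin 3 → ℝ)) :
    Integrable (T.indicator (extensionIntegrand ε c z n)) := by
  rw [← integrable_comp_sign_mul_add_iff hς (jbZ n)]
  simp_rw [indicator_extensionIntegrand ε c z n hς hTς]
  have hw : Continuous fun s => jbR s ^ (-(1 / 2 + ε)) := continuous_jbR_rpow _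
  have hα := measurable_piece hT hc ς
  refine ((integrable_jbR_rpow_sq hε).add (integrable_piece_sq hT hint hς)).mono' ?_
    (Filter.Eventually.of_forall fun s => ?_)
  · refine Measurable.aestronglyMeasurable ?_
    exact ((Complex.measurable_ofReal.comp hw.measurable).mul (by fun_prop)).mul
      (hα.mul_const _)
  · rw [norm_mul, norm_mul, norm_mul, norm_waveMode, Complex.norm_exp_ofReal_mul_I,
      Complex.norm_real, Real.norm_of_nonneg (jbR_rpow_nonneg _ _), mul_one, mul_one]
    simp only [Pi.add_apply]
    nlinarith [sq_nonneg (jbR s ^ (-(1 / 2 + ε)) - ‖T.indicator (c n) (ς * (s + jbZ n))‖),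
      sq_nonneg (jbR s ^ (-(1 / 2 + ε))), sq_nonneg ‖T.indicator (c n) (ς * (s + jbZ n))‖]

lemma enorm_sum_integral_indicator_le {S : Finset (Fin 3 → ℤ)} (hε : 0 < ε)
    (hT : MeasurableSet T) (hTς : ∀ τ ∈ T, |τ| = ς * τ) (hς : ς = 1 ∨ ς = -1)
    (hc : ∀ n ∈ S, Measurable (c n)) (hint : ∀ n ∈ S, Integrable fun τ => ‖c n τ‖ ^ 2)
    (z : ℝ × (Fin 3 → ℝ)) :
    ‖∑ n ∈ S, ∫ τ, T.indicator (extensionIntegrand ε c z n) τ‖ₑ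
      ≤ ∫⁻ s, ENNReal.ofReal (jbR s ^ (-(1 / 2 + ε))) *
          ‖∑ n ∈ S, T.indicator (c n) (ς * (s + jbZ n)) * waveMode n (ς * jbZ n) z‖ₑ := by
  have h1 : ∑ n ∈ S, ∫ τ, T.indicator (extensionIntegrand ε c z n) τ
      = ∫ s, ∑ n ∈ S, T.indicator (extensionIntegrand ε c z n) (ς * (s + jbZ n)) := by
    rw [integral_finsetSum]
    · exact Finset.sum_congr rfl fun n _ => (integral_comp_sign_mul_add _ hς _).symm
    · exact fun n hn => (integrable_comp_sign_mul_add_iff hς (jbZ n)).2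
        (integrable_indicator_extensionIntegrand hε hT hTς hς (hc n hn) (hint n hn) z)
  rw [h1]
  refine (enorm_integral_le_lintegral_enorm _).trans (le_of_eq (lintegral_congr fun s => ?_))
  simp_rw [indicator_extensionIntegrand ε c z _ hς hTς]
  rw [← Finset.mul_sum, enorm_mul, enorm_mul]
  congr 1
  rw [← ofReal_norm (Complex.exp _), Complex.norm_exp_ofReal_mul_I, ENNReal.ofReal_one, mul_one,
    ← ofReal_norm, Complex.norm_real, Real.norm_of_nonneg (jbR_rpow_nonneg _ _)]

end Pieces

lemma ENNReal.add_pow_four_le (x y : ENNReal) : (x + y) ^ 4 ≤ 16 * (x ^ 4 + y ^ 4) := by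
  rcases le_total x y with h | h
  · calc (x + y) ^ 4 ≤ (2 * y) ^ 4 := by
          rw [two_mul]
          gcongr
      _ = 16 * y ^ 4 := by rw [mul_pow]; norm_num
      _ ≤ 16 * (x ^ 4 + y ^ 4) := by gcongr; exact le_add_self
  · calc (x + y) ^ 4 ≤ (2 * x) ^ 4 := by
          rw [two_mul]
          gcongr
      _ = 16 * x ^ 4 := by rw [mul_pow]; norm_num
      _ ≤ 16 * (x ^ 4 + y ^ 4) := by gcongr; exact le_self_add

/-- **Dual weighted L⁴ Strichartz estimate** (Proposition 4.2, second estimate).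
For every bounded interval `I = [a,b] ⊂ ℝ` and every `ε > 0` there is a constant
`C(I, ε) > 0` such that for every `N ≥ 1` and every measurable
`c : S_N × ℝ → ℂ` with `∑_{n ∈ S_N} ∫ |c(n,τ)|² dτ < ∞`, the function
`g(t,x) = ∑_{n ∈ S_N} ∫ c(n,τ) ⟨|τ|-⟨n⟩⟩^{-(1/2+ε)} exp(i(n·x + tτ)) dτ` satisfies
`‖g‖_{L⁴(I × T³)} ≤ C(I,ε) N^{1/2} (∑_{n ∈ S_N} ∫ |c(n,τ)|² dτ)^{1/2}`. -/
theorem dual_weighted_strichartz_L4 (a b ε : ℝ) (hε : 0 < ε) :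
    ∃ C > (0:ℝ), ∀ N : ℝ, 1 ≤ N → ∀ c : (Fin 3 → ℤ) → ℝ → ℂ,
      (∀ n ∈ annulus N, Measurable (c n)) →
      (∀ n ∈ annulus N, Integrable (fun τ : ℝ => ‖c n τ‖ ^ 2)) →
      eLpNorm
        (fun p : ℝ × (Fin 3 → ℝ) =>
          ∑ n ∈ annulus N, ∫ τ : ℝ,
            c n τ * ((jbR (|τ| - jbZ n) ^ (-(1/2 + ε)) : ℝ) : ℂ) *
              Complex.exp (Complex.I * ((dotZ n p.2 + p.1 * τ : ℝ) : ℂ)))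
        4 (volume.restrict (Set.Icc a b ×ˢ cube)) ≤
      ENNReal.ofReal
        (C * N ^ ((1:ℝ)/2) * Real.sqrt (∑ n ∈ annulus N, ∫ τ : ℝ, ‖c n τ‖ ^ 2)) := by
  obtain ⟨C, hC, hsup⟩ := lintegral_superposition_pow_four_le a b hε
  refine ⟨(32 * C) ^ ((1 : ℝ) / 4), by positivity, fun N hN c hc hint => ?_⟩
  set S := annulus N
  set E := ∑ n ∈ S, ∫ τ : ℝ, ‖c n τ‖ ^ 2 with hE
  have hE0 : 0 ≤ E := Finset.sum_nonneg fun n _ => integral_nonneg fun τ => sq_nonneg _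
  let A : ℝ → Set ℝ → ℝ × (Fin 3 → ℝ) → ENNReal := fun ς T z =>
    ∫⁻ s, ENNReal.ofReal (jbR s ^ (-(1 / 2 + ε))) *
      ‖∑ n ∈ S, T.indicator (c n) (ς * (s + jbZ n)) * waveMode n (ς * jbZ n) z‖ₑ
  have hA : ∀ (ς : ℝ) (T : Set ℝ), MeasurableSet T → (ς = 1 ∨ ς = -1) →
      ∫⁻ z in Set.Icc a b ×ˢ cube, A ς T z ^ 4 ≤ ENNReal.ofReal (C * N ^ 2 * E ^ 2) := by
    intro ς T hT hς
    refine (hsup N hN ς (by rcases hς with rfl | rfl <;> norm_num)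
      (fun n s => T.indicator (c n) (ς * (s + jbZ n)))
      (fun n hn => measurable_piece hT (hc n hn) ς)
      (fun n hn => integrable_piece_sq hT (hint n hn) hς)).trans ?_
    refine ENNReal.ofReal_le_ofReal ?_
    have h0 : 0 ≤ ∑ n ∈ S, ∫ s, ‖T.indicator (c n) (ς * (s + jbZ n))‖ ^ 2 :=
      Finset.sum_nonneg fun n _ => integral_nonneg fun τ => sq_nonneg _
    gcongr
    exact Finset.sum_le_sum fun n hn => integral_piece_sq_le hT (hint n hn) hς
  have hAmeas : ∀ (ς : ℝ) (T : Set ℝ), MeasurableSet T → Measurable (A ς T) := by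
    intro ς T hT
    refine Measurable.lintegral_prod_right' (f := fun p : (ℝ × (Fin 3 → ℝ)) × ℝ =>
      ENNReal.ofReal (jbR p.2 ^ (-(1 / 2 + ε))) *
      ‖∑ n ∈ S, T.indicator (c n) (ς * (p.2 + jbZ n)) * waveMode n (ς * jbZ n) p.1‖ₑ) ?_
    refine ((continuous_jbR_rpow _).measurable.ennreal_ofReal.comp measurable_snd).mul
      (Measurable.enorm (Finset.measurable_fun_sum _ fun n hn => ?_))
    exact ((measurable_piece hT (hc n hn) ς).comp measurable_snd).mul
      ((continuous_waveMode n (ς * jbZ n)).measurable.comp measurable_fst)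
  have hpos : ∀ τ ∈ Set.Ici (0 : ℝ), |τ| = 1 * τ := fun τ hτ => by
    rw [one_mul, abs_of_nonneg hτ]
  have hneg : ∀ τ ∈ (Set.Ici (0 : ℝ))ᶜ, |τ| = -1 * τ := fun τ hτ => by
    rw [neg_one_mul, abs_of_neg (not_le.1 fun h => hτ h)]
  have hpt : ∀ z : ℝ × (Fin 3 → ℝ), ‖∑ n ∈ S, ∫ τ : ℝ, extensionIntegrand ε c z n τ‖ₑ ^ 4
      ≤ 16 * (A 1 (Set.Ici 0) z ^ 4 + A (-1) (Set.Ici 0)ᶜ z ^ 4) := fun z => by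
    have hsplit : ∑ n ∈ S, ∫ τ : ℝ, extensionIntegrand ε c z n τ
        = (∑ n ∈ S, ∫ τ, (Set.Ici (0 : ℝ)).indicator (extensionIntegrand ε c z n) τ)
          + ∑ n ∈ S, ∫ τ, (Set.Ici (0 : ℝ))ᶜ.indicator (extensionIntegrand ε c z n) τ := by
      rw [← Finset.sum_add_distrib]
      refine Finset.sum_congr rfl fun n hn => ?_
      rw [← integral_add
        (integrable_indicator_extensionIntegrand hε measurableSet_Ici hpos (Or.inl rfl)
          (hc n hn) (hint n hn) z)
        (integrable_indicator_extensionIntegrand hε measurableSet_Ici.compl hneg (Or.inr rfl)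
          (hc n hn) (hint n hn) z)]
      refine integral_congr_ae (Filter.Eventually.of_forall fun τ => ?_)
      exact (Set.indicator_self_add_compl_apply _ _ τ).symm
    rw [hsplit]
    refine le_trans ?_ (ENNReal.add_pow_four_le _ _)
    refine pow_le_pow_left₀ (by simp) ((enorm_add_le _ _).trans (add_le_add ?_ ?_)) 4
    · exact enorm_sum_integral_indicator_le hε measurableSet_Ici hpos (Or.inl rfl) hc hint z
    · exact enorm_sum_integral_indicator_le hε measurableSet_Ici.compl hneg (Or.inr rfl) hc hint z
  have hmain : ∫⁻ z in Set.Icc a b ×ˢ cube,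
      ‖∑ n ∈ S, ∫ τ : ℝ, extensionIntegrand ε c z n τ‖ₑ ^ 4
      ≤ ENNReal.ofReal (32 * C * N ^ 2 * E ^ 2) := by
    refine (lintegral_mono hpt).trans ?_
    rw [lintegral_const_mul' _ _ (by finiteness),
      lintegral_add_left ((hAmeas 1 _ measurableSet_Ici).pow_const 4)]
    refine (mul_le_mul_right (add_le_add (hA 1 _ measurableSet_Ici (Or.inl rfl))
      (hA (-1) _ measurableSet_Ici.compl (Or.inr rfl))) _).trans (le_of_eq ?_)
    rw [← ENNReal.ofReal_add (by positivity) (by positivity),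
      show (16 : ENNReal) = ENNReal.ofReal 16 by simp, ← ENNReal.ofReal_mul (by norm_num)]
    congr 1
    ring
  have hfinal : 32 * C * N ^ 2 * E ^ 2
      = ((32 * C) ^ ((1 : ℝ) / 4) * N ^ ((1 : ℝ) / 2) * Real.sqrt E) ^ 4 := by
    rw [mul_pow, mul_pow, ← Real.rpow_mul_natCast (by positivity),
      ← Real.rpow_mul_natCast (by positivity), show Real.sqrt E ^ 4 = (Real.sqrt E ^ 2) ^ 2 by ring,
      Real.sq_sqrt hE0]
    norm_num
  rw [eLpNorm_eq_lintegral_rpow_enorm_toReal (by norm_num) (by norm_num)]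
  have h4 : (4 : ENNReal).toReal = ((4 : ℕ) : ℝ) := by norm_num
  simp only [h4, ENNReal.rpow_natCast]
  rw [hfinal, ENNReal.ofReal_pow (by positivity)] at hmain
  refine (ENNReal.rpow_le_rpow hmain (by positivity)).trans (le_of_eq ?_)
  rw [one_div ((4 : ℕ) : ℝ), ENNReal.pow_rpow_inv_natCast (by norm_num)]
end

section
/- (Refined bilinear L² estimate for free Klein–Gordon waves, separated frequencies; Proposition 5.2, first case.) For every T > 0 there exists a constant C_T > 0 such that for all M, N, O ≥ 1 with 4M ≤ N, all signs σ₁, σ₂ ∈ {+1, −1} and all complex coefficients (a(m))_{m ∈ S_M}, (b(n))_{n ∈ S_N}, the corresponding free Klein–Gordon waves u, v satisfy ‖P_O(uv)‖_{L²([0,T] × T³)} ≤ C_T · min(O, M, N) · (∑_{m ∈ S_M} |a(m)|²)^{1/2} (∑_{n ∈ S_N} |b(n)|²)^{1/2}. -/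
open MeasureTheory

open scoped Classical in
/-- The frequency projection `P_O(uv)` of the product of the free Klein–Gordon waves
`u(t,x) = ∑_{m ∈ S_M} a(m) exp(i(m·x + σ₁ t⟨m⟩))` and
`v(t,x) = ∑_{n ∈ S_N} b(n) exp(i(n·x + σ₂ t⟨n⟩))`:
`P_O(uv)(t,x) = ∑_{k ∈ S_O} (∑_{m ∈ S_M, n ∈ S_N, m+n=k} a(m) b(n) e^{it(σ₁⟨m⟩+σ₂⟨n⟩)}) e^{ik·x}`. -/
noncomputable def projProdWave (O M N : ℝ) (σ₁ σ₂ : ℝ) (a b : (Fin 3 → ℤ) → ℂ)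
    (t : ℝ) (x : Fin 3 → ℝ) : ℂ :=
  ∑ k ∈ annulus O,
    (∑ m ∈ annulus M, ∑ n ∈ annulus N,
      if m + n = k then
        a m * b n * Complex.exp (Complex.I * ((t * (σ₁ * jbZ m + σ₂ * jbZ n) : ℝ) : ℂ))
      else 0) *
    Complex.exp (Complex.I * ((dotZ k x : ℝ) : ℂ))

theorem volume_le_of_normSq_le_add {F : Set (EuclideanSpace ℝ (Fin 2))} {L : ℝ} (hL : 0 ≤ L)
    (hF : ∀ y ∈ F, ∀ z ∈ F, ‖y‖ ^ 2 ≤ ‖z‖ ^ 2 + L) :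
    volume F ≤ ENNReal.ofReal (Real.pi * L) := by
  rcases F.eq_empty_or_nonempty with rfl | hne
  · simp
  set A := sInf ((fun y : EuclideanSpace ℝ (Fin 2) => ‖y‖ ^ 2) '' F) with hA
  have hbdd : BddBelow ((fun y : EuclideanSpace ℝ (Fin 2) => ‖y‖ ^ 2) '' F) :=
    ⟨0, by rintro _ ⟨y, -, rfl⟩; positivity⟩
  have hA0 : 0 ≤ A := Real.sInf_nonneg (by rintro _ ⟨y, -, rfl⟩; positivity)
  have hsub : F ⊆ Metric.closedBall 0 (√(A + L)) \ Metric.ball 0 (√A) := by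
    intro y hy
    have h1 : A ≤ ‖y‖ ^ 2 := csInf_le hbdd ⟨y, hy, rfl⟩
    have h2 : ‖y‖ ^ 2 - L ≤ A := by
      refine le_csInf (hne.image _) ?_
      rintro _ ⟨z, hz, rfl⟩
      have := hF y hy z hz
      simp only; linarith
    simp only [Set.mem_sdiff, mem_closedBall_zero_iff, mem_ball_zero_iff, not_lt]
    exact ⟨Real.le_sqrt_of_sq_le (by linarith), Real.sqrt_le_iff.2 ⟨norm_nonneg _, h1⟩⟩
  refine (measure_mono hsub).trans ?_
  rw [measure_sdiff ((Metric.ball_subset_closedBall).trans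
      (Metric.closedBall_subset_closedBall (Real.sqrt_le_sqrt (by linarith))))
      measurableSet_ball.nullMeasurableSet measure_ball_lt_top.ne,
    EuclideanSpace.volume_closedBall_fin_two, EuclideanSpace.volume_ball_fin_two,
    ← ENNReal.ofReal_pow (by positivity), ← ENNReal.ofReal_pow (by positivity),
    ← ENNReal.ofReal_mul (by positivity), ← ENNReal.ofReal_mul (by positivity),
    ← ENNReal.ofReal_sub _ (by positivity), Real.sq_sqrt (by positivity), Real.sq_sqrt hA0]
  exact ENNReal.ofReal_le_ofReal (by linarith)

theorem volume_le_of_slices {E : Set (EuclideanSpace ℝ (Fin 3))} (hE : MeasurableSet E)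
    {κ : EuclideanSpace ℝ (Fin 3)} (hκ : κ ≠ 0) {R L : ℝ} (hL : 0 ≤ L)
    (hR : ∀ x ∈ E, ‖x‖ ≤ R)
    (hs : ∀ x ∈ E, ∀ y ∈ E, inner ℝ κ x = inner ℝ κ y → ‖x‖ ^ 2 ≤ ‖y‖ ^ 2 + L) :
    volume E ≤ ENNReal.ofReal (2 * R * (Real.pi * L)) := by
  have hκ' : ‖κ‖ ≠ 0 := norm_ne_zero_iff.2 hκ
  obtain ⟨b, hb⟩ := Orthonormal.exists_orthonormalBasis_extension_of_card_eq (𝕜 := ℝ)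
    (E := EuclideanSpace ℝ (Fin 3)) (ι := Fin 3) (by simp)
    (v := fun _ => (‖κ‖⁻¹ : ℝ) • κ) (s := {0}) (by
      rw [orthonormal_iff_ite]
      rintro ⟨i, rfl⟩ ⟨j, rfl⟩
      simp only [Set.domRestrict_apply, real_inner_self_eq_norm_sq, norm_smul, norm_inv, norm_norm,
        inv_mul_cancel₀ hκ', one_pow, if_true])
  have hb0 := hb 0 rfl
  set Φ : ℝ × (Fin 2 → ℝ) ≃ᵐ EuclideanSpace ℝ (Fin 3) :=
    ((MeasurableEquiv.piFinSuccAbove (fun _ : Fin 3 => ℝ) 0).symm.trans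
      (MeasurableEquiv.toLp 2 (Fin 3 → ℝ))).trans b.measurableEquiv.symm with hΦdef
  have hΦ : MeasurePreserving Φ volume volume :=
    (((volume_preserving_piFinSuccAbove (fun _ : Fin 3 => ℝ) 0).symm _).trans
      (PiLp.volume_preserving_toLp (Fin 3))).trans b.measurePreserving_repr_symm
  have hrepr : ∀ h y, b.repr (Φ (h, y)) = WithLp.toLp 2 (Fin.cons h y : Fin 3 → ℝ) := by
    intro h y
    have : Φ (h, y) = b.repr.symm (WithLp.toLp 2 (Fin.cons h y : Fin 3 → ℝ)) := by
      rw [← Fin.insertNth_zero']; rfl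
    rw [this, LinearIsometryEquiv.apply_symm_apply]
  have hinner : ∀ h y, inner ℝ κ (Φ (h, y)) = ‖κ‖ * h := by
    intro h y
    have h1 : b.repr (Φ (h, y)) 0 = h := by rw [hrepr]; rfl
    rw [b.repr_apply_apply, hb0, real_inner_smul_left] at h1
    rw [← mul_inv_cancel_left₀ hκ' (inner ℝ κ (Φ (h, y))), h1]
  have hnorm : ∀ h y, ‖Φ (h, y)‖ ^ 2 =
      h ^ 2 + ‖(WithLp.toLp 2 y : EuclideanSpace ℝ (Fin 2))‖ ^ 2 := by
    intro h y
    rw [← b.repr.norm_map, hrepr, EuclideanSpace.norm_sq_eq, EuclideanSpace.norm_sq_eq,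
      Fin.sum_univ_succ]
    simp
  rw [← hΦ.measure_preimage hE.nullMeasurableSet, Measure.volume_eq_prod,
    Measure.prod_apply (Φ.measurable hE)]
  have hslice : ∀ h : ℝ, volume (Prod.mk h ⁻¹' (Φ ⁻¹' E)) ≤
      (Set.Icc (-R) R).indicator (fun _ => ENNReal.ofReal (Real.pi * L)) h := by
    intro h
    by_cases hh : h ∈ Set.Icc (-R) R
    · rw [Set.indicator_of_mem hh]
      have : Prod.mk h ⁻¹' (Φ ⁻¹' E) = (WithLp.toLp 2 : _ → EuclideanSpace ℝ (Fin 2)) ⁻¹'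
          {z | Φ (h, z.ofLp) ∈ E} := rfl
      have e := (EuclideanSpace.volume_preserving_symm_measurableEquiv_toLp
        (Fin 2)).symm.measure_preimage_equiv {z | Φ (h, z.ofLp) ∈ E}
      rw [this]
      refine (le_of_eq e).trans (volume_le_of_normSq_le_add hL ?_)
      intro y hy z hz
      have := hs _ hy _ hz (by rw [hinner, hinner])
      rw [hnorm, hnorm] at this
      simpa [add_assoc] using this
    · rw [Set.indicator_of_notMem hh, nonpos_iff_eq_zero]
      convert measure_empty (μ := volume)
      rw [Set.eq_empty_iff_forall_notMem]
      intro y hy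
      have h1 := hR _ hy
      have h2 := hnorm h y
      apply hh
      rw [Set.mem_Icc, ← abs_le]
      refine (abs_le_of_sq_le_sq ?_ (norm_nonneg _)).trans h1
      rw [h2]
      exact le_add_of_nonneg_right (sq_nonneg _)
  refine (lintegral_mono hslice).trans ?_
  rw [lintegral_indicator measurableSet_Icc, setLIntegral_const, Real.volume_Icc, mul_comm,
    ← ENNReal.ofReal_mul' (by positivity)]
  exact ENNReal.ofReal_le_ofReal (by linarith)

/-- The Japanese bracket `⟨x⟩ = (1 + |x|²)^{1/2}` of `x ∈ ℝ³`. -/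
noncomputable def bracket (x : EuclideanSpace ℝ (Fin 3)) : ℝ := √(1 + ‖x‖ ^ 2)

/-- The lattice point `n ∈ ℤ³` as an element of Euclidean space. -/
noncomputable def latticePt (n : Fin 3 → ℤ) : EuclideanSpace ℝ (Fin 3) :=
  WithLp.toLp 2 fun i => (n i : ℝ)

theorem norm_latticePt (n : Fin 3 → ℤ) : ‖latticePt n‖ = normZ n := by
  simp [EuclideanSpace.norm_eq, latticePt, normZ]

theorem bracket_latticePt (n : Fin 3 → ℤ) : bracket (latticePt n) = jbZ n := by
  simp [bracket, EuclideanSpace.norm_sq_eq, latticePt, jbZ]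

theorem latticePt_sub (k m : Fin 3 → ℤ) : latticePt (k - m) = latticePt k - latticePt m := by
  ext i; simp [latticePt]

theorem one_le_dist_latticePt {m n : Fin 3 → ℤ} (h : m ≠ n) :
    1 ≤ dist (latticePt m) (latticePt n) := by
  obtain ⟨i, hi⟩ := Function.ne_iff.1 h
  rw [dist_eq_norm, ← latticePt_sub]
  refine le_trans ?_ (PiLp.norm_apply_le _ i)
  have : (1 : ℝ) ≤ |((m i - n i : ℤ) : ℝ)| := by
    rw [← Int.cast_abs]
    exact_mod_cast Int.one_le_abs (sub_ne_zero.2 hi)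
  simpa [latticePt] using this

theorem sq_bracket (x : EuclideanSpace ℝ (Fin 3)) : bracket x ^ 2 = 1 + ‖x‖ ^ 2 :=
  Real.sq_sqrt (by positivity)

theorem bracket_pos (x : EuclideanSpace ℝ (Fin 3)) : 0 < bracket x :=
  Real.sqrt_pos.2 (by positivity)

theorem norm_le_bracket (x : EuclideanSpace ℝ (Fin 3)) : ‖x‖ ≤ bracket x :=
  Real.le_sqrt_of_sq_le (by linarith)

theorem continuous_bracket : Continuous bracket := by
  unfold bracket; fun_prop

theorem bracket_le_add (x y : EuclideanSpace ℝ (Fin 3)) : bracket x ≤ bracket y + ‖x - y‖ := by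
  have h1 := norm_le_norm_add_norm_sub' x y
  have h2 := norm_le_bracket y
  refine Real.sqrt_le_iff.2 ⟨add_nonneg (bracket_pos y).le (norm_nonneg _), ?_⟩
  nlinarith [sq_bracket y, norm_nonneg x, norm_nonneg y, norm_nonneg (x - y)]

theorem abs_bracket_sub_le (x y : EuclideanSpace ℝ (Fin 3)) :
    |bracket x - bracket y| ≤ ‖x - y‖ := by
  have h1 := bracket_le_add x y
  have h2 := bracket_le_add y x
  rw [norm_sub_rev] at h2
  rw [abs_le]; constructor <;> linarith

/-- If `w² - s² = w'² - s'²` and `w ≥ 3s/2`, `w' ≥ 3s'/2`, then `w` varies less than `s`, so that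
any signed combination of `s` and `w` controls `s`. -/
theorem sub_le_of_signed_sum_close {σ₁ σ₂ s s' w w' : ℝ} (h₁ : σ₁ = 1 ∨ σ₁ = -1)
    (h₂ : σ₂ = 1 ∨ σ₂ = -1) (hs : 0 < s) (hs' : 0 < s') (hw : 3 / 2 * s ≤ w)
    (hw' : 3 / 2 * s' ≤ w') (heq : w ^ 2 - s ^ 2 = w' ^ 2 - s' ^ 2)
    (hclose : |(σ₁ * s + σ₂ * w) - (σ₁ * s' + σ₂ * w')| ≤ 4) : s - s' ≤ 12 := by
  by_contra! hlt
  have hpos : 0 < w + w' := by linarith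
  have hww : (w - w') * (w + w') = (s - s') * (s + s') := by linarith
  have h0 : 0 ≤ w - w' := by
    by_contra! hneg
    nlinarith
  have h3 : w - w' ≤ 2 / 3 * (s - s') := by
    by_contra! hgt
    nlinarith
  rw [abs_le] at hclose
  rcases h₁ with rfl | rfl <;> rcases h₂ with rfl | rfl <;> linarith [hclose.1, hclose.2]

theorem volume_resonant_le {κ : EuclideanSpace ℝ (Fin 3)} (hκ : κ ≠ 0) {σ₁ σ₂ : ℝ}
    (h₁ : σ₁ = 1 ∨ σ₁ = -1) (h₂ : σ₂ = 1 ∨ σ₂ = -1) {M : ℝ} (hM : 0 < M) (μ : ℝ) :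
    volume {x : EuclideanSpace ℝ (Fin 3) | bracket x ≤ 5 / 2 * M ∧
      3 / 2 * bracket x ≤ bracket (κ - x) ∧
      |σ₁ * bracket x + σ₂ * bracket (κ - x) - μ| ≤ 2} ≤
    ENNReal.ofReal (300 * Real.pi * M ^ 2) := by
  have hc := continuous_bracket
  have hc' : Continuous fun x => bracket (κ - x) := hc.comp (continuous_const.sub continuous_id)
  have hmeas : MeasurableSet {x : EuclideanSpace ℝ (Fin 3) | bracket x ≤ 5 / 2 * M ∧
      3 / 2 * bracket x ≤ bracket (κ - x) ∧
      |σ₁ * bracket x + σ₂ * bracket (κ - x) - μ| ≤ 2} := by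
    refine IsClosed.measurableSet ?_
    refine (isClosed_le hc continuous_const).inter ((isClosed_le (hc.const_mul _) hc').inter
      (isClosed_le (((hc.const_mul _).add (hc'.const_mul _)).sub continuous_const).abs
        continuous_const))
  refine (volume_le_of_slices hmeas hκ (R := 5 / 2 * M) (L := 60 * M) (by positivity) ?_ ?_).trans
    (le_of_eq (by ring_nf))
  · exact fun x hx => (norm_le_bracket x).trans hx.1
  · rintro x ⟨hx1, hx2, hx3⟩ y ⟨hy1, hy2, hy3⟩ hxy
    have e : bracket (κ - x) ^ 2 - bracket x ^ 2 = bracket (κ - y) ^ 2 - bracket y ^ 2 := by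
      simp only [sq_bracket, norm_sub_sq_real, hxy]; ring
    have h := sub_le_of_signed_sum_close h₁ h₂ (bracket_pos x) (bracket_pos y) hx2 hy2 e (by
      rw [abs_le] at *; constructor <;> linarith [hx3.1, hx3.2, hy3.1, hy3.2])
    nlinarith [sq_bracket x, sq_bracket y, bracket_pos x, bracket_pos y]

/-- The basic counting estimate: at most `O(M²)` lattice points `m` with `|m| < 2M ≪ |k - m|` have
their phase `σ₁⟨m⟩ + σ₂⟨k - m⟩` within distance one of a given `μ`. -/
theorem card_resonant_le {σ₁ σ₂ : ℝ} (h₁ : σ₁ = 1 ∨ σ₁ = -1) (h₂ : σ₂ = 1 ∨ σ₂ = -1) {M : ℝ}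
    (hM : 1 ≤ M) (μ : ℝ) (k : Fin 3 → ℤ) (P : Finset (Fin 3 → ℤ))
    (hP : ∀ m ∈ P, normZ m < 2 * M ∧ 4 * M ≤ normZ (k - m) ∧
      |σ₁ * jbZ m + σ₂ * jbZ (k - m) - μ| ≤ 1) :
    (P.card : ℝ) ≤ 14400 * M ^ 2 := by
  rcases P.eq_empty_or_nonempty with rfl | ⟨m₀, hm₀⟩
  · simp; positivity
  have hk : latticePt k ≠ 0 := by
    intro h0
    obtain ⟨ha, hb, -⟩ := hP m₀ hm₀
    rw [← norm_latticePt] at ha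
    rw [← norm_latticePt, latticePt_sub, h0, zero_sub, norm_neg] at hb
    linarith
  have hdisj : Set.PairwiseDisjoint (↑P) fun m => Metric.ball (latticePt m) (1 / 4) := by
    intro m _ n _ hmn
    refine Metric.ball_disjoint_ball ?_
    linarith [one_le_dist_latticePt hmn]
  have hsub : (⋃ m ∈ P, Metric.ball (latticePt m) (1 / 4)) ⊆
      {x : EuclideanSpace ℝ (Fin 3) | bracket x ≤ 5 / 2 * M ∧
      3 / 2 * bracket x ≤ bracket (latticePt k - x) ∧
      |σ₁ * bracket x + σ₂ * bracket (latticePt k - x) - μ| ≤ 2} := by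
    refine Set.iUnion₂_subset fun m hm x hx => ?_
    rw [mem_ball_iff_norm] at hx
    obtain ⟨ha, hb, hc⟩ := hP m hm
    rw [← norm_latticePt] at ha hb
    rw [← bracket_latticePt, ← bracket_latticePt] at hc
    have d1 := abs_le.1 ((abs_bracket_sub_le x (latticePt m)).trans hx.le)
    have d2 := abs_bracket_sub_le (latticePt k - x) (latticePt (k - m))
    rw [latticePt_sub, sub_sub_sub_cancel_left, norm_sub_rev] at d2
    replace d2 := abs_le.1 (d2.trans hx.le)
    rw [latticePt_sub] at hb hc
    have e1 : bracket (latticePt m) ≤ 2 * M + 1 / 4 := by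
      refine Real.sqrt_le_iff.2 ⟨by positivity, ?_⟩
      nlinarith [norm_nonneg (latticePt m)]
    have e2 := hb.trans (norm_le_bracket _)
    refine ⟨by linarith [d1.2], by linarith [d1.2, d2.1], ?_⟩
    rw [abs_le] at hc ⊢
    rcases h₁ with rfl | rfl <;> rcases h₂ with rfl | rfl <;> constructor <;>
      linarith [d1.1, d1.2, d2.1, d2.2, hc.1, hc.2]
  have hvol := (measure_mono hsub).trans (volume_resonant_le hk h₁ h₂ (by linarith) μ)
  rw [measure_biUnion_finset hdisj fun _ _ => measurableSet_ball] at hvol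
  simp only [EuclideanSpace.volume_ball_fin_three, Finset.sum_const, nsmul_eq_mul] at hvol
  rw [← ENNReal.ofReal_natCast, ← ENNReal.ofReal_pow (by norm_num),
    ← ENNReal.ofReal_mul (by positivity), ← ENNReal.ofReal_mul (by positivity),
    ENNReal.ofReal_le_ofReal_iff (by positivity)] at hvol
  nlinarith [Real.pi_pos]

theorem ofReal_normSq_sum_exp {ι : Type*} (S : Finset ι) (c : ι → ℂ) (φ : ι → ℝ) :
    ((‖∑ i ∈ S, c i * Complex.exp (Complex.I * φ i)‖ ^ 2 : ℝ) : ℂ) =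
      ∑ i ∈ S, ∑ j ∈ S, c i * (starRingEnd ℂ) (c j) *
        Complex.exp (Complex.I * ((φ i - φ j : ℝ) : ℂ)) := by
  rw [Complex.ofReal_pow, ← Complex.mul_conj', map_sum, Finset.sum_mul_sum]
  refine Finset.sum_congr rfl fun i _ => Finset.sum_congr rfl fun j _ => ?_
  rw [map_mul, ← Complex.exp_conj, map_mul, Complex.conj_I, Complex.conj_ofReal,
    Complex.ofReal_sub, mul_sub, sub_eq_add_neg, Complex.exp_add, neg_mul]
  ring

theorem continuous_dotZ (k : Fin 3 → ℤ) : Continuous (dotZ k) := by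
  unfold dotZ; fun_prop

theorem integrableOn_cube {f : (Fin 3 → ℝ) → ℂ} (hf : Continuous f) :
    IntegrableOn f cube := by
  refine (hf.continuousOn.integrableOn_compact
    (isCompact_univ_pi fun _ : Fin 3 => isCompact_Icc (a := (0 : ℝ)) (b := 2 * Real.pi))).mono_set ?_
  exact Set.pi_mono fun _ _ => Set.Ico_subset_Icc_self

theorem integral_Ico_exp (n : ℤ) :
    ∫ x in Set.Ico (0 : ℝ) (2 * Real.pi), Complex.exp (Complex.I * ((n * x : ℝ) : ℂ)) =
      if n = 0 then ((2 * Real.pi : ℝ) : ℂ) else 0 := by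
  rw [integral_Ico_eq_integral_Ioc, ← intervalIntegral.integral_of_le (by positivity)]
  split_ifs with h
  · simp [h]
  · have hn : Complex.I * (n : ℂ) ≠ 0 := mul_ne_zero Complex.I_ne_zero (Int.cast_ne_zero.2 h)
    have := integral_exp_mul_complex (a := 0) (b := 2 * Real.pi) hn
    have e : Complex.exp (Complex.I * n * ((2 * Real.pi : ℝ) : ℂ)) = 1 := by
      rw [← Complex.exp_int_mul_two_pi_mul_I n]; push_cast; ring_nf
    rw [e] at this
    simpa [mul_assoc] using this

theorem integral_cube_exp (k : Fin 3 → ℤ) :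
    ∫ x in cube, Complex.exp (Complex.I * ((dotZ k x : ℝ) : ℂ)) =
      if k = 0 then (((2 * Real.pi) ^ 3 : ℝ) : ℂ) else 0 := by
  have h : ∀ x : Fin 3 → ℝ, Complex.exp (Complex.I * ((dotZ k x : ℝ) : ℂ)) =
      ∏ i, Complex.exp (Complex.I * ((k i * x i : ℝ) : ℂ)) := by
    intro x
    rw [← Complex.exp_sum, dotZ, Complex.ofReal_sum, Finset.mul_sum]
  simp_rw [h]
  rw [cube, volume_pi, Measure.restrict_pi_pi, integral_fintype_prod_eq_prod
    (f := fun i y => Complex.exp (Complex.I * ((k i * y : ℝ) : ℂ)))]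
  simp_rw [integral_Ico_exp]
  split_ifs with hk
  · simp [hk]
  · obtain ⟨i, hi⟩ := Function.ne_iff.1 hk
    exact Finset.prod_eq_zero (Finset.mem_univ i) (if_neg hi)

/-- Parseval's identity for trigonometric polynomials on the torus. -/
theorem integral_cube_normSq (S : Finset (Fin 3 → ℤ)) (g : (Fin 3 → ℤ) → ℂ) :
    ∫ x in cube, ‖∑ k ∈ S, g k * Complex.exp (Complex.I * ((dotZ k x : ℝ) : ℂ))‖ ^ 2 =
      (2 * Real.pi) ^ 3 * ∑ k ∈ S, ‖g k‖ ^ 2 := by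
  classical
  have hsub : ∀ (k l : Fin 3 → ℤ) (x : Fin 3 → ℝ), dotZ k x - dotZ l x = dotZ (k - l) x := by
    intro k l x
    simp only [dotZ, ← Finset.sum_sub_distrib, Pi.sub_apply, Int.cast_sub, sub_mul]
  have hint : ∀ (k l : Fin 3 → ℤ), IntegrableOn (fun x => g k * (starRingEnd ℂ) (g l) *
      Complex.exp (Complex.I * ((dotZ (k - l) x : ℝ) : ℂ))) cube := fun k l =>
    integrableOn_cube (by have := continuous_dotZ (k - l); fun_prop)
  apply Complex.ofReal_injective
  rw [← integral_complex_ofReal]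
  simp_rw [ofReal_normSq_sum_exp, hsub]
  rw [integral_finsetSum _ fun k _ => integrable_finsetSum _ fun l _ => hint k l]
  simp_rw [integral_finsetSum _ fun l _ => hint _ l, integral_const_mul, integral_cube_exp,
    sub_eq_zero, mul_ite, mul_zero, Finset.sum_ite_eq]
  push_cast
  rw [Finset.mul_sum]
  refine Finset.sum_congr rfl fun k hk => ?_
  rw [if_pos hk, Complex.mul_conj']
  ring

theorem integral_gaussian_exp (ξ : ℝ) :
    ∫ t : ℝ, Complex.exp (Complex.I * ((t * ξ : ℝ) : ℂ)) * Complex.exp (-(t : ℂ) ^ 2) =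
      ((√Real.pi * Real.exp (-ξ ^ 2 / 4) : ℝ) : ℂ) := by
  have h := fourierIntegral_gaussian (b := 1) (by simp) (ξ : ℂ)
  have hpi : ((√Real.pi : ℝ) : ℂ) = (Real.pi : ℂ) ^ (1 / 2 : ℂ) := by
    rw [Real.sqrt_eq_rpow, Complex.ofReal_cpow Real.pi_pos.le]; norm_num
  push_cast
  rw [hpi]
  simpa [mul_assoc, mul_comm, mul_left_comm] using h

theorem integrable_exp_mul_gaussian (c : ℂ) (ξ : ℝ) :
    Integrable fun t : ℝ => c * Complex.exp (Complex.I * ((t * ξ : ℝ) : ℂ)) *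
      Complex.exp (-(t : ℂ) ^ 2) := by
  have h : Integrable fun t : ℝ => Real.exp (-1 * t ^ 2) := integrable_exp_neg_mul_sq one_pos
  refine (h.const_mul ‖c‖).mono' (by fun_prop) (Filter.Eventually.of_forall fun t => le_of_eq ?_)
  rw [norm_mul, norm_mul, mul_comm Complex.I, Complex.norm_exp_ofReal_mul_I, mul_one,
    Complex.norm_exp]
  simp [← Complex.ofReal_pow]

theorem integrable_normSq_mul_gaussian {ι : Type*} (S : Finset ι) (c : ι → ℂ) (φ : ι → ℝ) :
    Integrable fun t : ℝ => ‖∑ i ∈ S, c i * Complex.exp (Complex.I * ((t * φ i : ℝ) : ℂ))‖ ^ 2 *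
      Real.exp (-t ^ 2) := by
  have h : Integrable fun t : ℝ => Real.exp (-1 * t ^ 2) := integrable_exp_neg_mul_sq one_pos
  refine (h.const_mul ((∑ i ∈ S, ‖c i‖) ^ 2)).mono' (by fun_prop)
    (Filter.Eventually.of_forall fun t => ?_)
  rw [Real.norm_of_nonneg (by positivity), neg_one_mul]
  gcongr
  refine (norm_sum_le _ _).trans (le_of_eq (Finset.sum_congr rfl fun i _ => ?_))
  rw [norm_mul, mul_comm Complex.I, Complex.norm_exp_ofReal_mul_I, mul_one]

/-- Almost orthogonality in time: with a Gaussian weight, an exponential sum is bounded by the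
square sum of its coefficients, up to the row sums of the Gaussian kernel of its frequencies. -/
theorem integral_normSq_mul_gaussian_le {ι : Type*} (S : Finset ι) (c : ι → ℂ) (φ : ι → ℝ)
    {R : ℝ} (hR : ∀ i ∈ S, ∑ j ∈ S, Real.exp (-(φ i - φ j) ^ 2 / 4) ≤ R) :
    ∫ t : ℝ, ‖∑ i ∈ S, c i * Complex.exp (Complex.I * ((t * φ i : ℝ) : ℂ))‖ ^ 2 *
      Real.exp (-t ^ 2) ≤ √Real.pi * R * ∑ i ∈ S, ‖c i‖ ^ 2 := by
  have hexp : (((∫ t : ℝ, ‖∑ i ∈ S, c i * Complex.exp (Complex.I * ((t * φ i : ℝ) : ℂ))‖ ^ 2 *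
      Real.exp (-t ^ 2)) : ℝ) : ℂ) = ∑ i ∈ S, ∑ j ∈ S, c i * (starRingEnd ℂ) (c j) *
        ((√Real.pi * Real.exp (-(φ i - φ j) ^ 2 / 4) : ℝ) : ℂ) := by
    rw [← integral_complex_ofReal]
    simp_rw [Complex.ofReal_mul (‖_‖ ^ 2), ofReal_normSq_sum_exp, ← mul_sub, Finset.sum_mul,
      Complex.ofReal_exp, Complex.ofReal_neg, Complex.ofReal_pow]
    rw [integral_finsetSum _ fun k _ => integrable_finsetSum _ fun l _ =>
      integrable_exp_mul_gaussian _ _]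
    simp_rw [integral_finsetSum _ fun l _ => integrable_exp_mul_gaussian _ _, mul_assoc,
      integral_const_mul, integral_gaussian_exp]
  have hnn : 0 ≤ ∫ t : ℝ, ‖∑ i ∈ S, c i * Complex.exp (Complex.I * ((t * φ i : ℝ) : ℂ))‖ ^ 2 *
      Real.exp (-t ^ 2) := integral_nonneg fun t => by positivity
  have hle := congrArg norm hexp
  rw [Complex.norm_real, Real.norm_of_nonneg hnn] at hle
  rw [hle]
  set K : ι → ι → ℝ := fun i j => Real.exp (-(φ i - φ j) ^ 2 / 4) with hK
  have hsymm : ∀ i j, K i j = K j i := fun i j => by simp only [hK]; ring_nf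
  calc _ ≤ ∑ i ∈ S, ∑ j ∈ S, √Real.pi * ((‖c i‖ ^ 2 * K i j + ‖c j‖ ^ 2 * K j i) / 2) := by
        refine (norm_sum_le _ _).trans (Finset.sum_le_sum fun i _ =>
          (norm_sum_le _ _).trans (Finset.sum_le_sum fun j _ => ?_))
        rw [norm_mul, norm_mul, RCLike.norm_conj, Complex.norm_real,
          Real.norm_of_nonneg (by positivity), hsymm j i]
        change _ * (_ * K i j) ≤ _
        have h1 : 0 ≤ √Real.pi * K i j := by positivity
        nlinarith [mul_nonneg h1 (sq_nonneg (‖c i‖ - ‖c j‖))]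
    _ = √Real.pi * ∑ i ∈ S, ‖c i‖ ^ 2 * ∑ j ∈ S, K i j := by
        simp_rw [← Finset.mul_sum, ← Finset.sum_div, Finset.sum_add_distrib]
        rw [Finset.sum_comm (f := fun i j => ‖c j‖ ^ 2 * K j i)]
        simp_rw [← Finset.mul_sum]
        ring
    _ ≤ √Real.pi * ∑ i ∈ S, ‖c i‖ ^ 2 * R := by
        gcongr with i hi; exact hR i hi
    _ = _ := by rw [← Finset.sum_mul]; ring

theorem summable_floor_weight : Summable fun l : ℤ => 16 / (1 + (l : ℝ) ^ 2) := by
  have h := (Real.summable_one_div_int_pow (p := 2)).2 one_lt_two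
  refine Summable.of_norm_bounded_eventually (h.mul_left 16) ?_
  filter_upwards [(Set.finite_singleton (0 : ℤ)).compl_mem_cofinite] with l hl
  have hl : (l : ℝ) ≠ 0 := by simpa using hl
  rw [Real.norm_of_nonneg (by positivity), mul_one_div]
  gcongr
  linarith

theorem sum_gaussian_le {ι : Type*} (S : Finset ι) (φ : ι → ℝ) {B : ℝ}
    (hB : ∀ μ : ℝ, ∀ P ⊆ S, (∀ i ∈ P, |φ i - μ| ≤ 1) → (P.card : ℝ) ≤ B) (ν : ℝ) :
    ∑ j ∈ S, Real.exp (-(ν - φ j) ^ 2 / 4) ≤ B * ∑' l : ℤ, 16 / (1 + (l : ℝ) ^ 2) := by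
  classical
  have hB0 : 0 ≤ B := by simpa using hB 0 ∅ (by simp) (by simp)
  set f : ι → ℤ := fun j => ⌊φ j - ν⌋ with hf
  have hterm : ∀ j, Real.exp (-(ν - φ j) ^ 2 / 4) ≤ 16 / (1 + (f j : ℝ) ^ 2) := by
    intro j
    have h1 := Int.floor_le (φ j - ν)
    have h2 := Int.lt_floor_add_one (φ j - ν)
    have h3 := Real.add_one_le_exp ((ν - φ j) ^ 2 / 4)
    rw [neg_div, Real.exp_neg, inv_eq_one_div, div_le_div_iff₀ (Real.exp_pos _) (by positivity)]
    simp only [hf]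
    nlinarith [sq_nonneg ((φ j - ν) + (φ j - ν - ⌊φ j - ν⌋)), sq_nonneg (φ j - ν)]
  calc _ ≤ ∑ j ∈ S, 16 / (1 + (f j : ℝ) ^ 2) := Finset.sum_le_sum fun j _ => hterm j
    _ = ∑ l ∈ S.image f, ∑ j ∈ S with f j = l, 16 / (1 + (f j : ℝ) ^ 2) :=
        (Finset.sum_fiberwise_of_maps_to (fun j hj => Finset.mem_image_of_mem f hj) _).symm
    _ ≤ ∑ l ∈ S.image f, B * (16 / (1 + (l : ℝ) ^ 2)) := by
        refine Finset.sum_le_sum fun l _ => ?_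
        rw [Finset.sum_congr rfl (g := fun _ => 16 / (1 + (l : ℝ) ^ 2))
          fun j hj => by rw [(Finset.mem_filter.1 hj).2], Finset.sum_const, nsmul_eq_mul]
        gcongr
        refine hB (ν + l) _ (Finset.filter_subset _ _) fun j hj => ?_
        have h1 := Int.floor_eq_iff.1 (Finset.mem_filter.1 hj).2
        rw [abs_le]; constructor <;> linarith [h1.1, h1.2]
    _ ≤ _ := by
        rw [← Finset.mul_sum]
        gcongr
        exact summable_floor_weight.sum_le_tsum _ fun l _ => by positivity

open scoped Classical in
/-- The frequency pairs `(m, n) ∈ S_M × S_N` with `m + n = k`. -/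
noncomputable def interactions (M N : ℝ) (k : Fin 3 → ℤ) :
    Finset ((Fin 3 → ℤ) × (Fin 3 → ℤ)) :=
  (annulus M ×ˢ annulus N).filter fun p => p.1 + p.2 = k

theorem mem_annulus {N : ℝ} {n : Fin 3 → ℤ} (h : n ∈ annulus N) :
    N ≤ normZ n ∧ normZ n < 2 * N :=
  (Finset.mem_filter.1 h).2

theorem mem_interactions {M N : ℝ} {k : Fin 3 → ℤ} {p : (Fin 3 → ℤ) × (Fin 3 → ℤ)} :
    p ∈ interactions M N k ↔ (p.1 ∈ annulus M ∧ p.2 ∈ annulus N) ∧ p.1 + p.2 = k := by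
  simp [interactions]

theorem projProdWave_eq (O M N σ₁ σ₂ : ℝ) (a b : (Fin 3 → ℤ) → ℂ) (t : ℝ) (x : Fin 3 → ℝ) :
    projProdWave O M N σ₁ σ₂ a b t x = ∑ k ∈ annulus O, (∑ p ∈ interactions M N k,
      a p.1 * b p.2 * Complex.exp (Complex.I * ((t * (σ₁ * jbZ p.1 + σ₂ * jbZ p.2) : ℝ) : ℂ))) *
      Complex.exp (Complex.I * ((dotZ k x : ℝ) : ℂ)) := by
  refine Finset.sum_congr rfl fun k _ => ?_
  rw [interactions, Finset.sum_filter, Finset.sum_product]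

theorem interactions_eq_empty {M N O : ℝ} (hMN : 4 * M ≤ N) (hO : O < M) {k : Fin 3 → ℤ}
    (hk : k ∈ annulus O) : interactions M N k = ∅ := by
  refine Finset.eq_empty_of_forall_notMem fun p hp => ?_
  obtain ⟨⟨h1, h2⟩, rfl⟩ := mem_interactions.1 hp
  have hn := norm_sub_le (latticePt (p.1 + p.2)) (latticePt p.1)
  rw [← latticePt_sub, add_sub_cancel_left] at hn
  simp only [norm_latticePt] at hn
  linarith [(mem_annulus hk).2, (mem_annulus h1).2, (mem_annulus h2).1]

theorem sum_gaussian_interactions_le {M N : ℝ} (hM : 1 ≤ M) (hMN : 4 * M ≤ N) {σ₁ σ₂ : ℝ}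
    (h₁ : σ₁ = 1 ∨ σ₁ = -1) (h₂ : σ₂ = 1 ∨ σ₂ = -1) (k : Fin 3 → ℤ) (ν : ℝ) :
    ∑ p ∈ interactions M N k, Real.exp (-(ν - (σ₁ * jbZ p.1 + σ₂ * jbZ p.2)) ^ 2 / 4) ≤
      14400 * M ^ 2 * ∑' l : ℤ, 16 / (1 + (l : ℝ) ^ 2) := by
  classical
  have hB : ∀ μ : ℝ, ∀ P ⊆ interactions M N k,
      (∀ p ∈ P, |σ₁ * jbZ p.1 + σ₂ * jbZ p.2 - μ| ≤ 1) → (P.card : ℝ) ≤ 14400 * M ^ 2 := by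
    intro μ P hP hμ
    have hsnd : ∀ p ∈ P, p.2 = k - p.1 := fun p hp =>
      eq_sub_of_add_eq' (mem_interactions.1 (hP hp)).2
    have hinj : Set.InjOn Prod.fst (P : Set ((Fin 3 → ℤ) × (Fin 3 → ℤ))) := by
      intro p hp q hq hpq
      refine Prod.ext hpq ?_
      rw [hsnd p hp, hsnd q hq, hpq]
    rw [← Finset.card_image_of_injOn hinj]
    refine card_resonant_le h₁ h₂ hM μ k _ fun m hm => ?_
    obtain ⟨p, hp, rfl⟩ := Finset.mem_image.1 hm
    have hmem := (mem_interactions.1 (hP hp)).1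
    rw [← hsnd p hp]
    exact ⟨(mem_annulus hmem.1).2, hMN.trans (mem_annulus hmem.2).1, hμ p hp⟩
  exact sum_gaussian_le (interactions M N k) (fun p => σ₁ * jbZ p.1 + σ₂ * jbZ p.2) hB ν

theorem sum_interactions_le (O M N : ℝ) (a b : (Fin 3 → ℤ) → ℂ) :
    ∑ k ∈ annulus O, ∑ p ∈ interactions M N k, ‖a p.1 * b p.2‖ ^ 2 ≤
      (∑ m ∈ annulus M, ‖a m‖ ^ 2) * ∑ n ∈ annulus N, ‖b n‖ ^ 2 := by
  classical
  simp only [interactions, norm_mul, mul_pow]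
  rw [Finset.sum_mul_sum, ← Finset.sum_product']
  convert! Finset.sum_fiberwise_le_sum_of_sum_fiber_nonneg
    (f := fun p : (Fin 3 → ℤ) × (Fin 3 → ℤ) => ‖a p.1‖ ^ 2 * ‖b p.2‖ ^ 2)
    (g := fun p => p.1 + p.2) fun k _ => Finset.sum_nonneg fun p _ => by positivity

theorem continuous_projProdWave (O M N σ₁ σ₂ : ℝ) (a b : (Fin 3 → ℤ) → ℂ) :
    Continuous fun p : ℝ × (Fin 3 → ℝ) => projProdWave O M N σ₁ σ₂ a b p.1 p.2 := by
  simp_rw [projProdWave_eq]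
  have := continuous_dotZ
  fun_prop

theorem lintegral_cube_normSq (S : Finset (Fin 3 → ℤ)) (g : (Fin 3 → ℤ) → ℂ) :
    ∫⁻ x in cube, ENNReal.ofReal
        (‖∑ k ∈ S, g k * Complex.exp (Complex.I * ((dotZ k x : ℝ) : ℂ))‖ ^ 2) =
      ENNReal.ofReal ((2 * Real.pi) ^ 3 * ∑ k ∈ S, ‖g k‖ ^ 2) := by
  have hd := continuous_dotZ
  rw [← integral_cube_normSq]
  refine (ofReal_integral_eq_lintegral_ofReal ?_
    (Filter.Eventually.of_forall fun x => by positivity)).symm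
  have := (integrableOn_cube (f := fun x => ((‖∑ k ∈ S, g k *
    Complex.exp (Complex.I * ((dotZ k x : ℝ) : ℂ))‖ ^ 2 : ℝ) : ℂ)) (by fun_prop)).re
  simpa only [RCLike.re_to_complex, Complex.ofReal_re] using this

theorem lintegral_normSq_projProdWave_le (T : ℝ) {O M N : ℝ} (hM : 1 ≤ M) (hMN : 4 * M ≤ N)
    {σ₁ σ₂ : ℝ} (h₁ : σ₁ = 1 ∨ σ₁ = -1) (h₂ : σ₂ = 1 ∨ σ₂ = -1) (a b : (Fin 3 → ℤ) → ℂ) :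
    ∫⁻ p in Set.Icc 0 T ×ˢ cube, ENNReal.ofReal (‖projProdWave O M N σ₁ σ₂ a b p.1 p.2‖ ^ 2) ≤
      ENNReal.ofReal ((2 * Real.pi) ^ 3 * Real.exp (T ^ 2) * √Real.pi * 14400 *
        (∑' l : ℤ, 16 / (1 + (l : ℝ) ^ 2)) * M ^ 2 *
        ((∑ m ∈ annulus M, ‖a m‖ ^ 2) * ∑ n ∈ annulus N, ‖b n‖ ^ 2)) := by
  set W := ∑' l : ℤ, 16 / (1 + (l : ℝ) ^ 2)
  have hW : 0 ≤ W := tsum_nonneg fun l => by positivity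
  set φ : (Fin 3 → ℤ) × (Fin 3 → ℤ) → ℝ := fun p => σ₁ * jbZ p.1 + σ₂ * jbZ p.2
  set G : (Fin 3 → ℤ) → ℝ → ℂ := fun k t => ∑ p ∈ interactions M N k,
    a p.1 * b p.2 * Complex.exp (Complex.I * ((t * φ p : ℝ) : ℂ)) with hG
  have hF : ∀ t x, projProdWave O M N σ₁ σ₂ a b t x = ∑ k ∈ annulus O, G k t *
      Complex.exp (Complex.I * ((dotZ k x : ℝ) : ℂ)) := fun t x => projProdWave_eq ..
  have hcont := continuous_projProdWave O M N σ₁ σ₂ a b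
  have hspace : ∀ t, ∫⁻ x in cube, ENNReal.ofReal (‖projProdWave O M N σ₁ σ₂ a b t x‖ ^ 2) =
      ENNReal.ofReal ((2 * Real.pi) ^ 3 * ∑ k ∈ annulus O, ‖G k t‖ ^ 2) := by
    intro t
    simp only [hF]
    exact lintegral_cube_normSq _ _
  have hint : ∀ k, Integrable fun t => ‖G k t‖ ^ 2 * Real.exp (-t ^ 2) := fun k =>
    integrable_normSq_mul_gaussian _ _ _
  rw [Measure.volume_eq_prod, ← Measure.prod_restrict, lintegral_prod _ (by fun_prop)]
  simp_rw [hspace]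
  calc _ ≤ ∫⁻ t in Set.Icc 0 T, ENNReal.ofReal ((2 * Real.pi) ^ 3 * Real.exp (T ^ 2) *
          ∑ k ∈ annulus O, ‖G k t‖ ^ 2 * Real.exp (-t ^ 2)) := by
        refine setLIntegral_mono' measurableSet_Icc fun t ht => ENNReal.ofReal_le_ofReal ?_
        rw [← Finset.sum_mul]
        have h1 : 1 ≤ Real.exp (T ^ 2) * Real.exp (-t ^ 2) := by
          rw [← Real.exp_add]
          exact Real.one_le_exp (by nlinarith [ht.1, ht.2])
        have h2 : 0 ≤ (2 * Real.pi) ^ 3 * ∑ k ∈ annulus O, ‖G k t‖ ^ 2 := by positivity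
        nlinarith [mul_le_mul_of_nonneg_left h1 h2]
    _ ≤ ∫⁻ t, ENNReal.ofReal ((2 * Real.pi) ^ 3 * Real.exp (T ^ 2) *
          ∑ k ∈ annulus O, ‖G k t‖ ^ 2 * Real.exp (-t ^ 2)) := setLIntegral_le_lintegral _ _
    _ = ENNReal.ofReal ((2 * Real.pi) ^ 3 * Real.exp (T ^ 2) *
          ∑ k ∈ annulus O, ∫ t, ‖G k t‖ ^ 2 * Real.exp (-t ^ 2)) := by
        rw [← integral_finsetSum _ fun k _ => hint k, ← integral_const_mul]
        exact (ofReal_integral_eq_lintegral_ofReal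
          ((integrable_finsetSum _ fun k _ => hint k).const_mul _)
          (Filter.Eventually.of_forall fun t => by positivity)).symm
    _ ≤ ENNReal.ofReal ((2 * Real.pi) ^ 3 * Real.exp (T ^ 2) * ∑ k ∈ annulus O,
          √Real.pi * (14400 * M ^ 2 * W) * ∑ p ∈ interactions M N k, ‖a p.1 * b p.2‖ ^ 2) := by
        refine ENNReal.ofReal_le_ofReal ?_
        gcongr with k hk
        exact integral_normSq_mul_gaussian_le _ _ _ fun p _ =>
          sum_gaussian_interactions_le hM hMN h₁ h₂ k (φ p)
    _ ≤ _ := by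
        refine ENNReal.ofReal_le_ofReal ?_
        rw [← Finset.mul_sum]
        calc _ ≤ (2 * Real.pi) ^ 3 * Real.exp (T ^ 2) * (√Real.pi * (14400 * M ^ 2 * W) *
              ((∑ m ∈ annulus M, ‖a m‖ ^ 2) * ∑ n ∈ annulus N, ‖b n‖ ^ 2)) := by
              gcongr; exact sum_interactions_le O M N a b
          _ = _ := by ring

/-- **Refined bilinear L² estimate for free Klein–Gordon waves, separated frequencies**
(Proposition 5.2, first case).  For every `T > 0` there is `C_T > 0` such that for all
`M, N, O ≥ 1` with `4M ≤ N`, all signs `σ₁, σ₂ ∈ {+1, -1}` and all coefficients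
`(a(m))_{m ∈ S_M}`, `(b(n))_{n ∈ S_N}`, the free waves `u, v` satisfy
`‖P_O(uv)‖_{L²([0,T]×T³)} ≤ C_T min(O,M,N) (∑|a(m)|²)^{1/2} (∑|b(n)|²)^{1/2}`. -/
theorem bilinear_L2_separated (T : ℝ) (hT : 0 < T) :
    ∃ C > (0:ℝ), ∀ M N O : ℝ, 1 ≤ M → 1 ≤ N → 1 ≤ O → 4 * M ≤ N →
      ∀ σ₁ σ₂ : ℝ, (σ₁ = 1 ∨ σ₁ = -1) → (σ₂ = 1 ∨ σ₂ = -1) →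
      ∀ a b : (Fin 3 → ℤ) → ℂ,
      eLpNorm (fun p : ℝ × (Fin 3 → ℝ) => projProdWave O M N σ₁ σ₂ a b p.1 p.2)
        2 (volume.restrict (Set.Icc 0 T ×ˢ cube)) ≤
      ENNReal.ofReal (C * min O (min M N) *
        Real.sqrt (∑ m ∈ annulus M, ‖a m‖ ^ 2) * Real.sqrt (∑ n ∈ annulus N, ‖b n‖ ^ 2)) := by
  set W := ∑' l : ℤ, 16 / (1 + (l : ℝ) ^ 2)
  have hW : 0 < W := summable_floor_weight.tsum_pos (fun l => by positivity) 0 (by positivity)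
  set D := (2 * Real.pi) ^ 3 * Real.exp (T ^ 2) * √Real.pi * 14400 * W with hD
  have hD0 : 0 < D := by positivity
  refine ⟨√D, Real.sqrt_pos.2 hD0, ?_⟩
  intro M N O hM hN hO hMN σ₁ σ₂ h₁ h₂ a b
  rcases lt_or_ge O M with hOM | hOM
  · have hzero : ∀ t x, projProdWave O M N σ₁ σ₂ a b t x = 0 := by
      intro t x
      rw [projProdWave_eq]
      refine Finset.sum_eq_zero fun k hk => ?_
      rw [interactions_eq_empty hMN hOM hk, Finset.sum_empty, zero_mul]
    simp [hzero]
  · rw [min_eq_left (show M ≤ N by linarith), min_eq_right hOM,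
      eLpNorm_eq_lintegral_rpow_enorm_toReal two_ne_zero ENNReal.ofNat_ne_top]
    rw [one_div, ENNReal.rpow_inv_le_iff (by norm_num)]
    simp only [ENNReal.toReal_ofNat, ENNReal.rpow_ofNat]
    rw [← ENNReal.ofReal_pow (by positivity)]
    simp_rw [← ofReal_norm, ← ENNReal.ofReal_pow (norm_nonneg _)]
    refine (lintegral_normSq_projProdWave_le T hM hMN h₁ h₂ a b).trans (le_of_eq ?_)
    change ENNReal.ofReal (D * M ^ 2 * _) = _
    rw [mul_pow, mul_pow, mul_pow, Real.sq_sqrt hD0.le, Real.sq_sqrt (by positivity),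
      Real.sq_sqrt (by positivity), mul_assoc (D * M ^ 2)]
end
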